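/- Let u be an infinite word satisfying property R_4 and let w be a weak bispecial factor of u. Then there exist factors w_1, w_2 of u, each of the form aw or wa for some letter a, and finite words v_1, v_2, v_3, v_4, such that R(w_1) = {v_1 v_3, v_1 v_4, v_2 v_3, v_2 v_4} and R(w_2) = {v_3 v_1, v_3 v_2, v_4 v_1, v_4 v_2}. -/

import Mathlib

variable {A : Type*}

/-- The factor of `u` of length `n` starting at position `j`. -/
def factorAt (u : ℕ → A) (j n : ℕ) : List A :=
  (List.range n).map (fun i => u (j + i))

/-- `j` is an occurrence of the finite word `w` in `u`. -/
def OccursAt (u : ℕ → A) (w : List A) (j : ℕ) : Prop :=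
  factorAt u j w.length = w

/-- `w` is a factor of the infinite word `u`. -/
def IsFactor (u : ℕ → A) (w : List A) : Prop :=
  ∃ j, OccursAt u w j

/-- `v` is a return word of `w` in `u`: the word between two successive occurrences of `w`. -/
def IsReturnWord (u : ℕ → A) (w v : List A) : Prop :=
  ∃ j k, j < k ∧ OccursAt u w j ∧ OccursAt u w k ∧
    (∀ l, j < l → l < k → ¬ OccursAt u w l) ∧ v = factorAt u j (k - j)

/-- The set `R(w)` of return words of `w` in `u`. -/
def returnWords (u : ℕ → A) (w : List A) : Set (List A) :=
  {v | IsReturnWord u w v}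

/-- Property `R_m`: every factor of `u` has exactly `m` return words. -/
def PropertyR (u : ℕ → A) (m : ℕ) : Prop :=
  ∀ w, IsFactor u w → (returnWords u w).Finite ∧ (returnWords u w).ncard = m

/-- The set of left extensions of `w`. -/
def leftExt (u : ℕ → A) (w : List A) : Set A := {a | IsFactor u (a :: w)}

/-- The set of right extensions of `w`. -/
def rightExt (u : ℕ → A) (w : List A) : Set A := {b | IsFactor u (w ++ [b])}

def LeftSpecial (u : ℕ → A) (w : List A) : Prop := 2 ≤ (leftExt u w).ncard

def RightSpecial (u : ℕ → A) (w : List A) : Prop := 2 ≤ (rightExt u w).ncard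

/-- The set of pairs `(a, b)` such that `a w b` is a factor of `u`. -/
def extPairs (u : ℕ → A) (w : List A) : Set (A × A) :=
  {p | IsFactor u (p.1 :: (w ++ [p.2]))}

/-- The bilateral order `B(w)`. -/
noncomputable def bilateralOrder (u : ℕ → A) (w : List A) : ℤ :=
  ((extPairs u w).ncard : ℤ) - (leftExt u w).ncard - (rightExt u w).ncard + 1

/-- `w` is a weak bispecial factor of `u`. -/
def WeakBispecial (u : ℕ → A) (w : List A) : Prop :=
  IsFactor u w ∧ bilateralOrder u w < 0

/-- The factor complexity of `u`. -/
noncomputable def Complexity (u : ℕ → A) (n : ℕ) : ℕ :=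
  {w : List A | w.length = n ∧ IsFactor u w}.ncard

/-- `u` is recurrent: every factor occurs at least twice. -/
def Recurrent (u : ℕ → A) : Prop :=
  ∀ w, IsFactor u w → ∃ j k, j < k ∧ OccursAt u w j ∧ OccursAt u w k

/-- `u` is uniformly recurrent. -/
def UniformlyRecurrent (u : ℕ → A) : Prop :=
  ∀ n : ℕ, ∃ N : ℕ, ∀ w, IsFactor u w → w.length = N →
    ∀ v, IsFactor u v → v.length = n → v <:+: w

def EventuallyPeriodic (u : ℕ → A) : Prop :=
  ∃ p, 0 < p ∧ ∃ N, ∀ n, N ≤ n → u (n + p) = u n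

/-- `w` is a maximal right special factor. -/
def MaximalRightSpecial (u : ℕ → A) (w : List A) : Prop :=
  IsFactor u w ∧ RightSpecial u w ∧
    ∀ v, IsFactor u v → RightSpecial u v → w <:+ v → v = w

/-- The return word `v` of `w` starts with the letter `b`. -/
def StartsWithLetter (w v : List A) (b : A) : Prop := (w ++ [b]) <+: (v ++ w)

theorem length_factorAt (f : ℕ → A) (j n : ℕ) : (factorAt f j n).length = n := by
  simp [factorAt]

theorem factorAt_eq_iff {f g : ℕ → A} {j k n m : ℕ} :
    factorAt f j n = factorAt g k m ↔ n = m ∧ ∀ i < n, f (j + i) = g (k + i) := by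
  constructor
  · intro h
    have hl := congrArg List.length h
    simp only [length_factorAt] at hl
    subst hl
    refine ⟨rfl, fun i hi => ?_⟩
    simpa [factorAt, hi] using congrArg (fun l => l[i]?) h
  · rintro ⟨rfl, h⟩
    exact List.map_congr_left fun i hi => h i (List.mem_range.1 hi)

theorem factorAt_add (f : ℕ → A) (j m n : ℕ) :
    factorAt f j (m + n) = factorAt f j m ++ factorAt f (j + m) n := by
  simp [factorAt, List.range_add, Function.comp_def, add_assoc]

theorem factorAt_one (f : ℕ → A) (j : ℕ) : factorAt f j 1 = [f j] := by
  simp [factorAt]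

theorem occursAt_factorAt_iff {u : ℕ → A} {k n j : ℕ} :
    OccursAt u (factorAt u k n) j ↔ ∀ i < n, u (j + i) = u (k + i) := by
  simp [OccursAt, length_factorAt, factorAt_eq_iff]

/-- Pairs of successive elements of the set of natural numbers satisfying `N`. -/
def retPairs (N : ℕ → Prop) : Set (ℕ × ℕ) :=
  {q | q.1 < q.2 ∧ N q.1 ∧ N q.2 ∧ ∀ l, q.1 < l → l < q.2 → ¬ N l}

/-- The words read in `x` between successive elements of `N`. -/
def retWords {S : Type*} (x : ℕ → S) (N : ℕ → Prop) : Set (List S) :=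
  (fun q : ℕ × ℕ => factorAt x q.1 (q.2 - q.1)) '' retPairs N

theorem retPairs_unique {N : ℕ → Prop} {s t t' : ℕ} (h : (s, t) ∈ retPairs N)
    (h' : (s, t') ∈ retPairs N) : t = t' := by
  obtain ⟨h1, -, h2, h3⟩ := h
  obtain ⟨h1', -, h2', h3'⟩ := h'
  rcases lt_trichotomy t t' with h | h | h
  · exact absurd h2 (h3' _ h1 h)
  · exact h
  · exact absurd h2' (h3 _ h1' h)

theorem ncard_image_le_of_determined {ι α β : Type*} {I : Set ι} {F : ι → α} {G : ι → β}
    (h : ∀ i ∈ I, ∀ j ∈ I, F i = F j → G i = G j) (hf : (F '' I).Finite) :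
    (G '' I).Finite ∧ (G '' I).ncard ≤ (F '' I).ncard := by
  classical
  rcases I.eq_empty_or_nonempty with rfl | ⟨i₀, -⟩
  · simp
  let φ : α → β := fun a => if h : ∃ i ∈ I, F i = a then G h.choose else G i₀
  have hφ : G '' I = φ '' (F '' I) := by
    rw [Set.image_image]
    refine Set.image_congr fun i hi => ?_
    have hex : ∃ i' ∈ I, F i' = F i := ⟨i, hi, rfl⟩
    simp only [φ, dif_pos hex]
    exact h _ hi _ hex.choose_spec.1 hex.choose_spec.2.symm
  rw [hφ]
  exact ⟨hf.image _, Set.ncard_image_le hf⟩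

theorem exists_ge_of_recurrent {S : Type*} {f : ℕ → S}
    (hf : ∀ m, ∃ k > 0, ∀ i < m, f (k + i) = f i) (t m N : ℕ) :
    ∃ s ≥ N, ∀ i < m, f (s + i) = f (t + i) := by
  induction N with
  | zero => exact ⟨t, Nat.zero_le _, fun _ _ => rfl⟩
  | succ N ih =>
    obtain ⟨s, hs, h⟩ := ih
    obtain ⟨k, hk, h'⟩ := hf (s + m)
    refine ⟨k + s, by omega, fun i hi => ?_⟩
    rw [← h i hi, ← h' (s + i) (by omega), add_assoc]

/-- Every factor of the sequence `x` has exactly four return words. -/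
def Fourfold {S : Type*} (x : ℕ → S) : Prop :=
  ∀ t m, (retWords x fun s => ∀ i ≤ m, x (s + i) = x (t + i)).Finite ∧
    (retWords x fun s => ∀ i ≤ m, x (s + i) = x (t + i)).ncard = 4

theorem Fourfold.exists_ge {S : Type*} {x : ℕ → S} (h : Fourfold x) (t m N : ℕ) :
    ∃ s ≥ N, ∀ i ≤ m, x (s + i) = x (t + i) := by
  have key : ∀ m, ∃ k > 0, ∀ i < m, x (k + i) = x i := by
    intro m
    have h4 := (h 0 m).2
    have hne : (retWords x fun s => ∀ i ≤ m, x (s + i) = x (0 + i)).Nonempty := by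
      rw [← Set.ncard_pos (h 0 m).1]; omega
    obtain ⟨_, ⟨q, hq, -⟩⟩ := hne
    refine ⟨q.2, by have := hq.1; omega, fun i hi => ?_⟩
    simpa using hq.2.2.1 i hi.le
  obtain ⟨s, hs, h'⟩ := exists_ge_of_recurrent key t (m + 1) N
  exact ⟨s, hs, fun i hi => h' i (by omega)⟩

/-- A sequence over `{a, b}` in which every factor has four return words and which contains
both squares of letters. -/
structure TwoFour {S : Type*} (x : ℕ → S) (a b : S) : Prop where
  ne : a ≠ b
  two : ∀ t, x t = a ∨ x t = b
  four : Fourfold x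
  fst_sq : ∃ t, x t = a ∧ x (t + 1) = a
  snd_sq : ∃ t, x t = b ∧ x (t + 1) = b

/-- At position `s`, the sequence reads `a b^k a^i b`. -/
def IsBlock {S : Type*} (x : ℕ → S) (a b : S) (s k i : ℕ) : Prop :=
  1 ≤ k ∧ 1 ≤ i ∧ x s = a ∧ (∀ l, 1 ≤ l → l ≤ k → x (s + l) = b) ∧
    (∀ l, k < l → l ≤ k + i → x (s + l) = a) ∧ x (s + k + i + 1) = b

/-- The pairs of lengths of successive runs, of `b` and then of `a`. -/
def blocks {S : Type*} (x : ℕ → S) (a b : S) : Set (ℕ × ℕ) :=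
  {q | ∃ s, IsBlock x a b s q.1 q.2}

namespace TwoFour

variable {S : Type*} {x : ℕ → S} {a b : S}

theorem symm (h : TwoFour x a b) : TwoFour x b a :=
  ⟨h.ne.symm, fun t => (h.two t).symm, h.four, h.snd_sq, h.fst_sq⟩

theorem pattern (h : TwoFour x a b) {N : ℕ → Prop} (c : ℕ → S) (m : ℕ)
    (hN : ∀ s, N s ↔ ∀ i ≤ m, x (s + i) = c i) (hex : ∃ t, N t) :
    (retWords x N).Finite ∧ (retWords x N).ncard = 4 := by
  obtain ⟨t, ht⟩ := hex
  have : N = fun s => ∀ i ≤ m, x (s + i) = x (t + i) := by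
    funext s
    rw [eq_iff_iff, hN]
    exact forall₂_congr fun i hi => by rw [(hN t).1 ht i hi]
  rw [this]
  exact h.four t m

theorem exists_fst_ge (h : TwoFour x a b) (n : ℕ) : ∃ s ≥ n, x s = a := by
  obtain ⟨t, ht, -⟩ := h.fst_sq
  obtain ⟨s, hs, h'⟩ := h.four.exists_ge t 0 n
  exact ⟨s, hs, by simpa [ht] using h' 0 le_rfl⟩

theorem eq_snd (h : TwoFour x a b) {t : ℕ} (ht : x t ≠ a) : x t = b := (h.two t).resolve_left ht

/-- A run of `b` starting at `s` ends. -/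
theorem exists_run (h : TwoFour x a b) {s : ℕ} (hs : x s = b) :
    ∃ k ≥ 1, (∀ l < k, x (s + l) = b) ∧ x (s + k) = a := by
  classical
  have hex : ∃ k, x (s + k) = a := by
    obtain ⟨t, ht, h'⟩ := h.exists_fst_ge s
    exact ⟨t - s, by rwa [Nat.add_sub_cancel' ht]⟩
  refine ⟨Nat.find hex, ?_, fun l hl => h.eq_snd (Nat.find_min hex hl), Nat.find_spec hex⟩
  rw [ge_iff_le, Nat.one_le_iff_ne_zero]
  intro h0
  have := Nat.find_spec hex
  rw [h0, add_zero, hs] at this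
  exact h.ne this.symm

theorem exists_block (h : TwoFour x a b) {s : ℕ} (hs : x s = a) (hs' : x (s + 1) = b) :
    ∃ k i, IsBlock x a b s k i := by
  obtain ⟨k, hk, h1, h2⟩ := h.exists_run hs'
  obtain ⟨i, hi, h3, h4⟩ := h.symm.exists_run h2
  refine ⟨k, i, hk, hi, hs, fun l hl hl' => ?_, fun l hl hl' => ?_, ?_⟩
  · have := h1 (l - 1) (by omega)
    rwa [show s + 1 + (l - 1) = s + l by omega] at this
  · have := h3 (l - k - 1) (by omega)
    rwa [show s + 1 + k + (l - k - 1) = s + l by omega] at this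
  · rwa [show s + k + i + 1 = s + 1 + k + i by omega]

theorem exists_fst_snd (h : TwoFour x a b) (n : ℕ) : ∃ s ≥ n, x s = a ∧ x (s + 1) = b := by
  obtain ⟨s, hs, h1⟩ := h.exists_fst_ge n
  obtain ⟨k, hk, h2, h3⟩ := h.symm.exists_run h1
  refine ⟨s + (k - 1), by omega, h2 _ (by omega), ?_⟩
  rwa [show s + (k - 1) + 1 = s + k by omega]

theorem blocks_finite (h : TwoFour x a b) :
    (blocks x a b).Finite ∧ (blocks x a b).ncard ≤ 4 := by
  have h4 := h.pattern (N := fun s => x s = a ∧ x (s + 1) = b) (fun i => if i = 0 then a else b) 1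
    (fun s => by
      constructor
      · rintro ⟨h1, h2⟩ i hi
        interval_cases i <;> simpa
      · intro h'
        exact ⟨by simpa using h' 0 (by omega), by simpa using h' 1 (by omega)⟩)
    (let ⟨s, _, h'⟩ := h.exists_fst_snd 0; ⟨s, h'⟩)
  let I : Set (ℕ × ℕ × ℕ) := {q | IsBlock x a b q.1 q.2.1 q.2.2}
  let F : ℕ × ℕ × ℕ → List S := fun q => factorAt x q.1 (q.2.1 + q.2.2)
  have hsub : F '' I ⊆ retWords x fun s => x s = a ∧ x (s + 1) = b := by
    rintro _ ⟨⟨s, k, i⟩, ⟨hk, hi, h0, h1, h2, h3⟩, rfl⟩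
    simp only at hk hi h0 h1 h2 h3
    refine ⟨(s, s + k + i), ⟨by simp only; omega, ⟨h0, h1 1 le_rfl hk⟩, ⟨?_, h3⟩, ?_⟩, ?_⟩
    · have := h2 (k + i) (by omega) le_rfl
      rwa [← add_assoc] at this
    · rintro l hl hl' ⟨h4, h5⟩
      simp only at hl hl'
      obtain ⟨d, rfl⟩ := Nat.exists_eq_add_of_lt hl
      by_cases hd : d + 1 ≤ k
      · exact h.ne (h4.symm.trans (h1 (d + 1) (by omega) hd))
      · exact h.ne ((h2 (d + 2) (by omega) (by omega)).symm.trans h5)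
    · simp only [F]
      congr 1
      omega
  have hcount := ncard_image_le_of_determined (I := I) (F := F) (G := fun q => q.2) ?_
    (h4.1.subset hsub)
  · have himg : (fun q : ℕ × ℕ × ℕ => q.2) '' I = blocks x a b := by
      ext ⟨k, i⟩
      constructor
      · rintro ⟨⟨s, k', i'⟩, h', h''⟩
        obtain ⟨rfl, rfl⟩ := Prod.mk.inj h''
        exact ⟨s, h'⟩
      · rintro ⟨s, h'⟩
        exact ⟨(s, k, i), h', rfl⟩
    rw [himg] at hcount
    exact ⟨hcount.1, hcount.2.trans ((Set.ncard_le_ncard hsub h4.1).trans h4.2.le)⟩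
  · have key : ∀ s k i s' k' i', IsBlock x a b s k i → IsBlock x a b s' k' i' →
        k + i = k' + i' → (∀ l < k + i, x (s + l) = x (s' + l)) → ¬ k < k' := by
      rintro s k i s' k' i' ⟨hk, hi, h0, h1, h2, h3⟩ ⟨hk', hi', h0', h1', h2', h3'⟩ hl he hlt
      have e1 := h2 (k + 1) (by omega) (by omega)
      have e2 := h1' (k + 1) (by omega) (by omega)
      rw [he _ (by omega), e2] at e1
      exact h.ne e1.symm
    rintro ⟨s, k, i⟩ hq ⟨s', k', i'⟩ hq' he
    obtain ⟨hl, he⟩ := factorAt_eq_iff.1 he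
    simp only [I, Set.mem_ofPred_eq] at hq hq' hl he
    have h1 := key _ _ _ _ _ _ hq hq' hl he
    have h2 := key _ _ _ _ _ _ hq' hq hl.symm fun l hl' => (he l (by omega)).symm
    simp only [Prod.mk.injEq]
    omega

theorem runs_finite (h : TwoFour x a b) : (Prod.fst '' blocks x a b).Finite :=
  h.blocks_finite.1.image _

theorem three_le_runs (h : TwoFour x a b) : 3 ≤ (Prod.fst '' blocks x a b).ncard := by
  have h4 := h.pattern (N := fun s => x s = a) (fun _ => a) 0 (fun s => by simp)
    (let ⟨s, _, h'⟩ := h.exists_fst_ge 0; ⟨s, h'⟩)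
  have hsub : retWords x (fun s => x s = a) ⊆
      insert [a] ((fun k => a :: List.replicate k b) '' (Prod.fst '' blocks x a b)) := by
    rintro _ ⟨⟨s, t⟩, ⟨h1, h2, h3, h5⟩, rfl⟩
    simp only at h1 h2 h3 h5
    simp only
    by_cases hst : t = s + 1
    · left
      subst hst
      rw [Nat.add_sub_cancel_left, factorAt_one, h2]
    · right
      have hb : x (s + 1) = b := h.eq_snd (h5 _ (by omega) (by omega))
      obtain ⟨k, i, hB⟩ := h.exists_block h2 hb
      refine ⟨k, ⟨(k, i), ⟨s, hB⟩, rfl⟩, ?_⟩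
      obtain ⟨hk, hi, -, hb1, hb2, -⟩ := hB
      have ha := hb2 (k + 1) (by omega) (by omega)
      have ht : t = s + (k + 1) := by
        rcases lt_trichotomy t (s + (k + 1)) with h' | h' | h'
        · have := hb1 (t - s) (by omega) (by omega)
          rw [Nat.add_sub_cancel' h1.le, h3] at this
          exact absurd this h.ne
        · exact h'
        · exact absurd ha (h5 _ (by omega) h')
      subst ht
      simp only
      rw [Nat.add_sub_cancel_left, add_comm k 1, factorAt_add, factorAt_one, h2,
        List.singleton_append]
      congr 1
      symm
      rw [List.eq_replicate_iff]
      refine ⟨length_factorAt _ _ _, fun y hy => ?_⟩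
      simp only [factorAt, List.mem_map, List.mem_range] at hy
      obtain ⟨l, hl, rfl⟩ := hy
      rw [add_assoc]
      exact hb1 _ (by omega) (by omega)
  have hfin : ((fun k => a :: List.replicate k b) '' (Prod.fst '' blocks x a b)).Finite :=
    h.runs_finite.image _
  have h1 := Set.ncard_le_ncard hsub (hfin.insert _)
  have h2 := Set.ncard_insert_le [a]
    ((fun k => a :: List.replicate k b) '' (Prod.fst '' blocks x a b))
  have h3 : ((fun k => a :: List.replicate k b) '' (Prod.fst '' blocks x a b)).ncard ≤ _ :=
    Set.ncard_image_le h.runs_finite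
  omega

/-- No run of `b` is longer than the maximal one. -/
theorem not_long (h : TwoFour x a b) {M : ℕ} (hM : M ∈ upperBounds (Prod.fst '' blocks x a b))
    (s : ℕ) : ¬ ∀ i ≤ M, x (s + i) = b := by
  intro hs
  obtain ⟨t, -, ht⟩ := h.exists_fst_ge 0
  obtain ⟨s', hs', h'⟩ := h.four.exists_ge s M (t + 1)
  have hb : ∀ i ≤ M, x (s' + i) = b := fun i hi => (h' i hi).trans (hs i hi)
  obtain ⟨p, hp, hpa, hmax⟩ : ∃ p < s', x p = a ∧ ∀ l, p < l → l < s' → x l = b := by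
    classical
    refine ⟨Nat.findGreatest (fun p => x p = a) (s' - 1), ?_, ?_, fun l hl hl' => ?_⟩
    · have := Nat.findGreatest_le (P := fun p => x p = a) (s' - 1)
      omega
    · exact Nat.findGreatest_spec (P := fun p => x p = a) (show t ≤ s' - 1 by omega) ht
    · exact h.eq_snd (Nat.findGreatest_is_greatest hl (by omega))
  have hall : ∀ l, p < l → l ≤ s' + M → x l = b := by
    intro l hl hl'
    by_cases hls : l < s'
    · exact hmax l hl hls
    · have := hb (l - s') (by omega)
      rwa [Nat.add_sub_cancel' (by omega)] at this
  obtain ⟨k, i, hB⟩ := h.exists_block hpa (hall (p + 1) (by omega) (by omega))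
  have hkM : k ≤ M := hM ⟨(k, i), ⟨p, hB⟩, rfl⟩
  have := hB.2.2.2.2.1 (k + 1) (by omega) (by have := hB.2.1; omega)
  rw [hall _ (by omega) (by omega)] at this
  exact h.ne this.symm

end TwoFour

theorem exists_ambiguous {S : Type*} {x : ℕ → S} {N Q : ℕ → Prop} {m : ℕ}
    (hf : (retWords x N).Finite) (hN : (retWords x N).ncard ≤ m)
    (hQ : m ≤ (retWords x Q).ncard) {w : List S} (hw : w ∈ retWords x N)
    (F : ℕ × ℕ → List S) (hF : ∀ q ∈ retPairs Q, F q ∈ retWords x N ∧ F q ≠ w) :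
    ∃ q ∈ retPairs Q, ∃ q' ∈ retPairs Q, F q = F q' ∧
      factorAt x q.1 (q.2 - q.1) ≠ factorAt x q'.1 (q'.2 - q'.1) := by
  by_contra! hcon
  have hsub : F '' retPairs Q ⊆ retWords x N \ {w} := by
    rintro _ ⟨q, hq, rfl⟩
    exact ⟨(hF q hq).1, (hF q hq).2⟩
  have h1 := ncard_image_le_of_determined (I := retPairs Q) (F := F) hcon
    ((hf.subset Set.sdiff_subset).subset hsub)
  have h2 := Set.ncard_le_ncard hsub (hf.subset Set.sdiff_subset)
  have h3 := Set.ncard_sdiff_singleton_lt_of_mem hw hf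
  have h4 : (retWords x Q).ncard ≤ _ := h1.2
  omega

namespace TwoFour

variable {S : Type*} {x : ℕ → S} {a b : S}

theorem run_pattern (h : TwoFour x a b) {j : ℕ} (hj : 1 ≤ j)
    (hex : ∃ t, ∀ i < j, x (t + i) = b) :
    (retWords x fun s => ∀ i < j, x (s + i) = b).Finite ∧
      (retWords x fun s => ∀ i < j, x (s + i) = b).ncard = 4 :=
  h.pattern (fun _ => b) (j - 1)
    (fun s => ⟨fun h' i hi => h' i (by omega), fun h' i hi => h' i (by omega)⟩) hex

theorem three_le_of_isGreatest (h : TwoFour x a b) {M : ℕ}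
    (hM : IsGreatest (Prod.fst '' blocks x a b) M) : 3 ≤ M := by
  have hsub : Prod.fst '' blocks x a b ⊆ (Finset.Icc 1 M : Finset ℕ) := by
    intro k hk
    have := hM.2 hk
    obtain ⟨⟨k, i⟩, ⟨s, hs⟩, rfl⟩ := hk
    simp only [Finset.coe_Icc, Set.mem_Icc]
    exact ⟨hs.1, this⟩
  have h1 := Set.ncard_le_ncard hsub (Finset.finite_toSet _)
  rw [Set.ncard_coe_finset, Nat.card_Icc] at h1
  have := h.three_le_runs
  omega

theorem singleton_mem_retWords {j s : ℕ} (hs : ∀ i < j + 1, x (s + i) = b) (hj : 1 ≤ j) :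
    [b] ∈ retWords x fun s => ∀ i < j, x (s + i) = b := by
  refine ⟨(s, s + 1), ⟨Nat.lt_succ_self s, fun i hi => hs i (by omega), fun i hi => ?_,
    fun l h1 h2 => by simp only at h1 h2; omega⟩, ?_⟩
  · have := hs (i + 1) (by omega)
    rwa [show s + 1 + i = s + (i + 1) by omega]
  · simp only [Nat.add_sub_cancel_left, factorAt_one]
    rw [show x s = b from hs 0 (by omega)]

/-- Some run of `a` is followed by runs of `b` of the two largest lengths. -/
theorem exists_common_pred (h : TwoFour x a b) {j : ℕ}
    (hM : IsGreatest (Prod.fst '' blocks x a b) (j + 1)) :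
    ∃ i, (i, j) ∈ blocks x b a ∧ (i, j + 1) ∈ blocks x b a := by
  classical
  have hj : 2 ≤ j := by have := h.three_le_of_isGreatest hM; omega
  obtain ⟨⟨k, i⟩, ⟨s₀, hk, hi, h0, h1, h2, h3⟩, hkj⟩ := hM.1
  simp only at hk hi h0 h1 h2 h3 hkj
  subst hkj
  have hrun : ∀ i < j + 1, x (s₀ + 1 + i) = b := fun i hi => by
    rw [add_assoc]; exact h1 _ (by omega) (by omega)
  have hB4 := h.run_pattern (j := j) (by omega) ⟨s₀ + 1, fun i hi => hrun i (by omega)⟩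
  have hQ4 := h.pattern (N := fun s => (∀ i < j, x (s + i) = b) ∧ x (s + j) = a)
    (fun i => if i < j then b else a) j
    (fun s => by
      constructor
      · rintro ⟨h4, h5⟩ i hi
        rcases hi.lt_or_eq with hi | rfl
        · simp only [hi, if_true]; exact h4 i hi
        · simpa using h5
      · intro h4
        refine ⟨fun i hi => by simpa [hi] using h4 i hi.le, by simpa using h4 j le_rfl⟩)
    ⟨s₀ + 2, fun i hi => by
        rw [add_assoc]; exact h1 _ (by omega) (by omega), by
        have := h2 (j + 2) (by omega) (by omega)
        rwa [show s₀ + 2 + j = s₀ + (j + 2) by omega]⟩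
  let e : ℕ × ℕ → ℕ := fun q => if x (q.2 - 1) = a then q.2 else q.2 - 1
  set Q : ℕ → Prop := fun s => (∀ i < j, x (s + i) = b) ∧ x (s + j) = a with hQ
  have gap : ∀ q ∈ retPairs Q, q.1 + j + 1 ≤ e q := by
    rintro ⟨s, s'⟩ ⟨hlt, ⟨hs, hs1⟩, ⟨hs', -⟩, -⟩
    simp only at hlt hs hs1 hs' ⊢
    have : s + j + 1 ≤ s' := by
      by_contra hc
      have := hs' (s + j - s') (by omega)
      rw [Nat.add_sub_cancel' (by omega), hs1] at this
      exact h.ne this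
    simp only [e]
    split_ifs with hc
    · exact this
    · have : s' - 1 ≠ s + j := fun hc' => hc (by rw [hc', hs1])
      omega
  obtain ⟨q, hq, q', hq', hF, hG⟩ := exists_ambiguous (Q := Q) hB4.1 hB4.2.le hQ4.2.ge
    (singleton_mem_retWords hrun (by omega)) (fun q => factorAt x q.1 (e q - q.1)) (by
      intro q hq
      have hgap := gap q hq
      refine ⟨⟨(q.1, e q), ⟨by simp only; omega, hq.2.1.1, ?_, ?_⟩, rfl⟩, ?_⟩
      · simp only [e]
        split_ifs with hc
        · exact hq.2.2.1.1
        · intro i hi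
          have hb := h.eq_snd hc
          rcases Nat.eq_zero_or_pos i with rfl | hi0
          · exact hb
          · have := hq.2.2.1.1 (i - 1) (by omega)
            have hlt := hq.1
            rwa [show q.2 + (i - 1) = q.2 - 1 + i by omega] at this
      · intro l hl hl' hBl
        simp only at hl hl'
        have hle : e q ≤ q.2 := by simp only [e]; split_ifs <;> omega
        by_cases hla : x (l + j) = a
        · exact hq.2.2.2 l hl (by omega) ⟨hBl, hla⟩
        · have hlb := h.eq_snd hla
          have hla' : x (l + 1 + j) = a := by
            by_contra hc
            refine h.not_long hM.2 l fun i hi => ?_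
            rcases Nat.lt_trichotomy i j with hi' | rfl | hi'
            · exact hBl i hi'
            · exact hlb
            · rw [show i = j + 1 by omega, show l + (j + 1) = l + 1 + j by omega]
              exact h.eq_snd hc
          have hQl : Q (l + 1) := by
            refine ⟨fun i hi => ?_, hla'⟩
            rw [add_assoc]
            rcases (show 1 + i ≤ j by omega).lt_or_eq with hi' | hi'
            · exact hBl _ hi'
            · rw [hi']; exact hlb
          have hl2 : l + 1 = q.2 := by
            by_contra hc
            exact hq.2.2.2 (l + 1) (by omega) (by omega) hQl
          have hxl : x l = b := hBl 0 (by omega)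
          simp only [e, ← hl2, Nat.add_sub_cancel, hxl, h.ne.symm, if_false] at hl'
          omega
      · intro hc
        have := congrArg List.length hc
        simp only [length_factorAt, List.length_singleton] at this
        omega)
  obtain ⟨hlen, heq⟩ := factorAt_eq_iff.1 hF
  have key : ∀ q ∈ retPairs Q, ∀ q' ∈ retPairs Q, e q - q.1 = e q' - q'.1 →
      (∀ i < e q - q.1, x (q.1 + i) = x (q'.1 + i)) → x (q.2 - 1) = a → x (q'.2 - 1) ≠ a →
      ∃ i, (i, j) ∈ blocks x b a ∧ (i, j + 1) ∈ blocks x b a := by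
    rintro ⟨s, s'⟩ hq ⟨r, r'⟩ hq' hlen heq ha hb
    have hg := gap _ hq
    have hg' := gap _ hq'
    simp only [e] at hlen heq ha hb hg hg'
    rw [if_pos ha] at hlen heq hg
    rw [if_neg hb] at hlen hg'
    obtain ⟨-, ⟨hs, -⟩, ⟨hs', hs1⟩, -⟩ := hq
    obtain ⟨-, ⟨hr, -⟩, ⟨hr', hr1⟩, -⟩ := hq'
    simp only at hs hs' hs1 hr hr' hr1
    set p := Nat.findGreatest (fun l => x (s + l) = b) (s' - 1 - s) with hp
    have hple : p ≤ s' - 1 - s := Nat.findGreatest_le _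
    have hpb : x (s + p) = b := Nat.findGreatest_spec (P := fun l => x (s + l) = b)
      (Nat.zero_le _) (hs 0 (by omega))
    have hpa : ∀ l, p < l → l ≤ s' - 1 - s → x (s + l) = a := fun l hl hl' =>
      h.symm.eq_snd (Nat.findGreatest_is_greatest hl hl')
    have hpne : p ≠ s' - 1 - s := by
      intro hc
      rw [hc, show s + (s' - 1 - s) = s' - 1 by omega, ha] at hpb
      exact h.ne hpb
    refine ⟨s' - 1 - s - p, ⟨s + p, by simp only; omega, by simp only; omega, hpb, ?_, ?_, ?_⟩,
      ⟨r + p, by simp only; omega, by simp only; omega, ?_, ?_, ?_, ?_⟩⟩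
    · intro l hl hl'
      simp only at hl hl'
      rw [add_assoc]; exact hpa _ (by omega) (by omega)
    · intro l hl hl'
      simp only at hl hl'
      have := hs' (s + p + l - s') (by omega)
      rwa [Nat.add_sub_cancel' (by omega)] at this
    · simp only
      rwa [show s + p + (s' - 1 - s - p) + j + 1 = s' + j by omega]
    · rw [← heq p (by omega)]; exact hpb
    · intro l hl hl'
      simp only at hl hl'
      rw [add_assoc, ← heq _ (by omega)]; exact hpa _ (by omega) (by omega)
    · intro l hl hl'
      simp only at hl hl'
      rcases (show r' - 1 ≤ r + p + l by omega).lt_or_eq with h' | h'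
      · have := hr' (r + p + l - r') (by omega)
        rwa [Nat.add_sub_cancel' (by omega)] at this
      · rw [← h']; exact h.eq_snd hb
    · simp only
      rwa [show r + p + (s' - 1 - s - p) + (j + 1) + 1 = r' + j by omega]
  by_cases h1 : x (q.2 - 1) = a <;> by_cases h2 : x (q'.2 - 1) = a
  · simp only [e, if_pos h1, if_pos h2] at hF
    exact absurd hF hG
  · exact key q hq q' hq' hlen heq h1 h2
  · exact key q' hq' q hq hlen.symm (fun i hi => (heq i (by omega)).symm) h2 h1
  · refine absurd ?_ hG
    have hg := gap _ hq
    have hg' := gap _ hq'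
    simp only [e, if_neg h1, if_neg h2] at hF hg hg'
    have e1 : q.2 - q.1 = (q.2 - 1 - q.1) + 1 := by omega
    have e2 : q'.2 - q'.1 = (q'.2 - 1 - q'.1) + 1 := by omega
    rw [e1, e2, factorAt_add, factorAt_add, hF, factorAt_one, factorAt_one,
      show q.1 + (q.2 - 1 - q.1) = q.2 - 1 by omega,
      show q'.1 + (q'.2 - 1 - q'.1) = q'.2 - 1 by omega, h.eq_snd h1, h.eq_snd h2]

end TwoFour

namespace TwoFour

variable {S : Type*} {x : ℕ → S} {a b : S}

theorem fst_run_pattern (h : TwoFour x a b) {j : ℕ} {t : ℕ} (ht : x t = a)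
    (ht' : ∀ i < j, x (t + 1 + i) = b) :
    (retWords x fun s => x s = a ∧ ∀ i < j, x (s + 1 + i) = b).Finite ∧
      (retWords x fun s => x s = a ∧ ∀ i < j, x (s + 1 + i) = b).ncard = 4 :=
  h.pattern (fun i => if i = 0 then a else b) j
    (fun s => by
      constructor
      · rintro ⟨h4, h5⟩ i hi
        rcases Nat.eq_zero_or_pos i with rfl | hi0
        · simpa using h4
        · have := h5 (i - 1) (by omega)
          rw [show s + 1 + (i - 1) = s + i by omega] at this
          simpa [hi0.ne'] using this
      · intro h4
        refine ⟨by simpa using h4 0 (by omega), fun i hi => ?_⟩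
        have := h4 (1 + i) (by omega)
        simpa [add_assoc] using this)
    ⟨t, ht, ht'⟩

/-- Runs of `b` of the two largest lengths are followed by the same run of `a`. -/
theorem exists_common_succ (h : TwoFour x a b) {j : ℕ}
    (hM : IsGreatest (Prod.fst '' blocks x a b) (j + 1)) :
    ∃ i, (j, i) ∈ blocks x a b ∧ (j + 1, i) ∈ blocks x a b := by
  classical
  have hj : 2 ≤ j := by have := h.three_le_of_isGreatest hM; omega
  obtain ⟨⟨k, i⟩, ⟨s₀, hk, hi, h0, h1, h2, h3⟩, hkj⟩ := hM.1
  simp only at hk hi h0 h1 h2 h3 hkj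
  subst hkj
  have hrun : ∀ i < j + 1, x (s₀ + 1 + i) = b := fun i hi => by
    rw [add_assoc]; exact h1 _ (by omega) (by omega)
  have hB4 := h.run_pattern (j := j) (by omega) ⟨s₀ + 1, fun i hi => hrun i (by omega)⟩
  have hQ4 := h.fst_run_pattern (j := j) h0 fun i hi => hrun i (by omega)
  let e : ℕ × ℕ → ℕ := fun q => if x (q.1 + 1 + j) = a then q.1 + 1 else q.1 + 2
  set Q : ℕ → Prop := fun s => x s = a ∧ ∀ i < j, x (s + 1 + i) = b with hQ
  have gap : ∀ q ∈ retPairs Q, e q + j ≤ q.2 := by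
    rintro ⟨s, s'⟩ ⟨hlt, ⟨hs, hs1⟩, ⟨hs', -⟩, -⟩
    simp only at hlt hs hs1 hs' ⊢
    have : s + 1 + j ≤ s' := by
      by_contra hc
      have := hs1 (s' - (s + 1)) (by omega)
      rw [Nat.add_sub_cancel' (by omega), hs'] at this
      exact h.ne this
    simp only [e]
    split_ifs with hc
    · exact this
    · have : s' ≠ s + 1 + j := fun hc' => hc (by rw [← hc', hs'])
      omega
  obtain ⟨q, hq, q', hq', hF, hG⟩ := exists_ambiguous (Q := Q) hB4.1 hB4.2.le hQ4.2.ge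
    (singleton_mem_retWords hrun (by omega)) (fun q => factorAt x (e q) (q.2 + 1 - e q)) (by
      intro q hq
      have hgap := gap q hq
      refine ⟨⟨(e q, q.2 + 1), ⟨by simp only; omega, ?_, hq.2.2.1.2, ?_⟩, rfl⟩, ?_⟩
      · simp only [e]
        split_ifs with hc
        · exact hq.2.1.2
        · intro i hi
          rw [show q.1 + 2 + i = q.1 + 1 + (i + 1) by omega]
          rcases (show i + 1 ≤ j by omega).lt_or_eq with hi' | hi'
          · exact hq.2.1.2 _ hi'
          · rw [hi']; exact h.eq_snd hc
      · intro l hl hl' hBl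
        simp only at hl hl'
        have hle : q.1 + 1 ≤ e q := by simp only [e]; split_ifs <;> omega
        by_cases hla : x (l - 1) = a
        · refine hq.2.2.2 (l - 1) (by omega) (by omega) ⟨hla, ?_⟩
          rwa [show l - 1 + 1 = l by omega]
        · have hlb := h.eq_snd hla
          have hB2 : ∀ i < j + 1, x (l - 1 + i) = b := by
            intro i hi
            rcases Nat.eq_zero_or_pos i with rfl | hi0
            · exact hlb
            · have := hBl (i - 1) (by omega)
              rwa [show l + (i - 1) = l - 1 + i by omega] at this
          have hla' : x (l - 2) = a := by
            by_contra hc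
            refine h.not_long hM.2 (l - 2) fun i hi => ?_
            rcases Nat.eq_zero_or_pos i with rfl | hi0
            · exact h.eq_snd hc
            · have := hB2 (i - 1) (by omega)
              rwa [show l - 1 + (i - 1) = l - 2 + i by omega] at this
          have hQl : Q (l - 2) := by
            refine ⟨hla', fun i hi => ?_⟩
            have := hB2 i (by omega)
            rwa [show l - 1 + i = l - 2 + 1 + i by omega] at this
          have hl2 : l = q.1 + 2 := by
            by_contra hc
            exact hq.2.2.2 (l - 2) (by omega) (by omega) hQl
          have hxl := hB2 j (by omega)
          rw [show l - 1 + j = q.1 + 1 + j by omega] at hxl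
          simp only [e, hxl, h.ne.symm, if_false] at hl
          omega
      · intro hc
        have := congrArg List.length hc
        simp only [length_factorAt, List.length_singleton] at this
        omega)
  obtain ⟨hlen, heq⟩ := factorAt_eq_iff.1 hF
  have key : ∀ q ∈ retPairs Q, ∀ q' ∈ retPairs Q, q.2 + 1 - e q = q'.2 + 1 - e q' →
      (∀ i < q.2 + 1 - e q, x (e q + i) = x (e q' + i)) → x (q.1 + 1 + j) = a →
      x (q'.1 + 1 + j) ≠ a →
      ∃ i, (j, i) ∈ blocks x a b ∧ (j + 1, i) ∈ blocks x a b := by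
    rintro ⟨s, s'⟩ hq ⟨r, r'⟩ hq' hlen heq ha hb
    have hg := gap _ hq
    have hg' := gap _ hq'
    simp only [e] at hlen heq ha hb hg hg'
    rw [if_pos ha] at hlen hg
    simp only [if_pos ha, if_neg hb] at heq
    rw [if_neg hb] at hlen hg'
    obtain ⟨-, ⟨hs, hs1⟩, ⟨hs', hs1'⟩, -⟩ := hq
    obtain ⟨-, ⟨hr, hr1⟩, ⟨hr', hr1'⟩, -⟩ := hq'
    simp only at hs hs' hs1 hr hr' hr1 hs1' hr1'
    have heq' : ∀ l ≤ s' - s, x (s + 1 + l) = x (r + 2 + l) := by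
      intro l hl
      rcases hl.lt_or_eq with hl | rfl
      · exact heq l (by omega)
      · have e1 := hs1' 0 (by omega)
        have e2 := hr1' 0 (by omega)
        rw [add_zero] at e1 e2
        rw [show s + 1 + (s' - s) = s' + 1 by omega, show r + 2 + (s' - s) = r' + 1 by omega,
          e1, e2]
    obtain ⟨i, hi, hia, hib⟩ := h.symm.exists_run ha
    have hile : j + i ≤ s' - s := by
      by_contra hc
      have e1 := hs1' 0 (by omega)
      have e2 := hia (s' - s - j) (by omega)
      rw [show s + 1 + j + (s' - s - j) = s' + 1 + 0 by omega, e1] at e2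
      exact h.ne e2.symm
    refine ⟨i, ⟨s, by simp only; omega, hi, hs, ?_, ?_, ?_⟩,
      ⟨r, by simp only; omega, hi, hr, ?_, ?_, ?_⟩⟩
    · intro l hl hl'
      simp only at hl hl'
      have := hs1 (l - 1) (by omega)
      rwa [show s + 1 + (l - 1) = s + l by omega] at this
    · intro l hl hl'
      simp only at hl hl'
      have := hia (l - 1 - j) (by omega)
      rwa [show s + 1 + j + (l - 1 - j) = s + l by omega] at this
    · simp only
      rwa [show s + j + i + 1 = s + 1 + j + i by omega]
    · intro l hl hl'
      simp only at hl hl'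
      rcases hl'.lt_or_eq with hl' | rfl
      · have := hr1 (l - 1) (by omega)
        rwa [show r + 1 + (l - 1) = r + l by omega] at this
      · rw [show r + (j + 1) = r + 1 + j by omega]; exact h.eq_snd hb
    · intro l hl hl'
      simp only at hl hl'
      have := hia (l - 2 - j) (by omega)
      rw [show s + 1 + j + (l - 2 - j) = s + 1 + (l - 2) by omega, heq' _ (by omega)] at this
      rwa [show r + 2 + (l - 2) = r + l by omega] at this
    · simp only
      rw [add_assoc, heq' _ hile] at hib
      rwa [show r + (j + 1) + i + 1 = r + 2 + (j + i) by omega]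
  have split : ∀ q ∈ retPairs Q, factorAt x q.1 (q.2 - q.1) ++ [a] =
      (if x (q.1 + 1 + j) = a then [a] else [a, b]) ++ factorAt x (e q) (q.2 + 1 - e q) := by
    intro q hq
    have hg := gap q hq
    have ha : [a] = factorAt x q.2 1 := by rw [factorAt_one, hq.2.2.1.1]
    have hlt := hq.1
    have e1 : factorAt x q.1 (q.2 - q.1) ++ [a] = factorAt x q.1 (q.2 - q.1 + 1) := by
      rw [factorAt_add, ha, Nat.add_sub_cancel' hlt.le]
    have ha' : [a] = factorAt x q.1 1 := by rw [factorAt_one, hq.2.1.1]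
    have hb' : [b] = factorAt x (q.1 + 1) 1 := by
      rw [factorAt_one, show x (q.1 + 1) = b from hq.2.1.2 0 (by omega)]
    rw [e1]
    simp only [e] at hg ⊢
    split_ifs at hg ⊢ with hc
    · rw [ha', ← factorAt_add]
      congr 1
      omega
    · rw [show [a, b] = [a] ++ [b] from rfl, ha', hb', ← factorAt_add, ← factorAt_add]
      congr 1
      omega
  by_cases h1 : x (q.1 + 1 + j) = a <;> by_cases h2 : x (q'.1 + 1 + j) = a
  · have e1 := split q hq
    have e2 := split q' hq'
    rw [if_pos h2] at e2
    rw [if_pos h1, hF, ← e2] at e1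
    exact absurd (List.append_cancel_right e1) hG
  · exact key q hq q' hq' hlen heq h1 h2
  · exact key q' hq' q hq hlen.symm (fun i hi => (heq i (by omega)).symm) h2 h1
  · have e1 := split q hq
    have e2 := split q' hq'
    rw [if_neg h2] at e2
    rw [if_neg h1, hF, ← e2] at e1
    exact absurd (List.append_cancel_right e1) hG

end TwoFour

namespace TwoFour

variable {S : Type*} {x : ℕ → S} {a b : S}

/-- Successive blocks of the sequence. -/
theorem exists_runs (h : TwoFour x a b) :
    ∃ z k i : ℕ → ℕ, (∀ t, IsBlock x a b (z t) (k t) (i t)) ∧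
      (∀ t, z (t + 1) = z t + k t + i t) ∧
      ∀ s, z 0 ≤ s → x s = a → x (s + 1) = b → ∃ t, z t = s := by
  obtain ⟨s₀, -, h₀⟩ := h.exists_fst_snd 0
  let Start := {s : ℕ // x s = a ∧ x (s + 1) = b}
  have hex : ∀ s : Start, ∃ q : ℕ × ℕ, IsBlock x a b s.1 q.1 q.2 := fun s => by
    obtain ⟨k, i, hB⟩ := h.exists_block s.2.1 s.2.2
    exact ⟨(k, i), hB⟩
  choose f hf using hex
  have hnext : ∀ s : Start, x (s.1 + (f s).1 + (f s).2) = a ∧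
      x (s.1 + (f s).1 + (f s).2 + 1) = b := fun s => by
    obtain ⟨hk, hi, h0, h1, h2, h3⟩ := hf s
    refine ⟨?_, h3⟩
    rw [add_assoc]
    exact h2 _ (by omega) le_rfl
  let nxt : Start → Start := fun s => ⟨_, hnext s⟩
  let y : ℕ → Start := fun t => nxt^[t] ⟨s₀, h₀⟩
  have hy : ∀ t, y (t + 1) = nxt (y t) := fun t => Function.iterate_succ_apply' _ _ _
  have hz : ∀ t, (y (t + 1)).1 = (y t).1 + (f (y t)).1 + (f (y t)).2 := fun t => by rw [hy]
  refine ⟨fun t => (y t).1, fun t => (f (y t)).1, fun t => (f (y t)).2, fun t => hf _, hz, ?_⟩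
  intro s hs ha hb
  have hmono : StrictMono fun t => (y t).1 := strictMono_nat_of_lt_succ fun t => by
    have := (hf (y t)).1
    have := hz t
    omega
  have hgr := Nat.findGreatest_spec (P := fun t => (y t).1 ≤ s) (Nat.zero_le s) hs
  have hgr' := Nat.findGreatest_is_greatest (P := fun t => (y t).1 ≤ s) (n := s)
    (Nat.lt_succ_self _)
  set t := Nat.findGreatest (fun t => (y t).1 ≤ s) s
  clear_value t
  refine ⟨t, ?_⟩
  have hlt : s < (y (t + 1)).1 := by
    by_contra hc
    exact hgr' ((hmono.id_le _).trans (not_lt.1 hc)) (not_lt.1 hc)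
  rw [hz] at hlt
  obtain ⟨hk, hi, h0, h1, h2, h3⟩ := hf (y t)
  simp only at hgr ⊢
  by_contra hne
  obtain ⟨d, rfl⟩ := Nat.exists_eq_add_of_lt (lt_of_le_of_ne hgr hne)
  by_cases hd : d + 1 ≤ (f (y t)).1
  · have := h1 (d + 1) (by omega) hd
    rw [← add_assoc, ha] at this
    exact h.ne this
  · have := h2 (d + 2) (by omega) (by omega)
    rw [show (y t).1 + (d + 2) = (y t).1 + d + 1 + 1 by omega, hb] at this
    exact h.ne this.symm

theorem isBlock_unique (h : TwoFour x a b) {s k i k' i' : ℕ} (hB : IsBlock x a b s k i)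
    (hB' : IsBlock x a b s k' i') : k = k' ∧ i = i' := by
  have key : ∀ {k i k' i' : ℕ}, IsBlock x a b s k i → IsBlock x a b s k' i' →
      ¬ k < k' ∧ (k = k' → ¬ i < i') := by
    rintro k i k' i' ⟨hk, hi, h0, h1, h2, h3⟩ ⟨hk', hi', h0', h1', h2', h3'⟩
    refine ⟨fun hlt => ?_, ?_⟩
    · exact h.ne ((h2 (k + 1) (by omega) (by omega)).symm.trans (h1' (k + 1) (by omega) hlt))
    · rintro rfl hlt
      have := h2' (k + i + 1) (by omega) (by omega)
      rw [show s + (k + i + 1) = s + k + i + 1 by omega, h3] at this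
      exact h.ne this.symm
  have h1 := key hB hB'
  have h2 := key hB' hB
  omega

theorem isBlock_of_eq {s s' k i : ℕ} (hB : IsBlock x a b s k i)
    (he : ∀ l ≤ k + i + 1, x (s' + l) = x (s + l)) : IsBlock x a b s' k i := by
  obtain ⟨hk, hi, h0, h1, h2, h3⟩ := hB
  refine ⟨hk, hi, ?_, fun l hl hl' => ?_, fun l hl hl' => ?_, ?_⟩
  · have := he 0 (by omega)
    rw [add_zero, add_zero] at this
    rw [this, h0]
  · rw [he l (by omega)]; exact h1 l hl hl'
  · rw [he l (by omega)]; exact h2 l hl hl'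
  · have := he (k + i + 1) le_rfl
    simp only [← add_assoc] at this
    rw [this, h3]

theorem isBlock_succ {s k i k' i' : ℕ} (hB : IsBlock x a b s k i)
    (hB' : IsBlock x a b (s + k + i) k' i') : IsBlock x b a (s + k) i k' := by
  obtain ⟨hk, hi, h0, h1, h2, h3⟩ := hB
  obtain ⟨hk', hi', h0', h1', h2', h3'⟩ := hB'
  refine ⟨hi, hk', h1 k hk le_rfl, fun l hl hl' => ?_, fun l hl hl' => ?_, ?_⟩
  · rw [add_assoc]; exact h2 _ (by omega) (by omega)
  · have := h1' (l - i) (by omega) (by omega)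
    rwa [show s + k + i + (l - i) = s + k + l by omega] at this
  · exact h2' (k' + 1) (by omega) (by omega)

/-- Every run of `a` that is followed by a run of `b` is also preceded by one. -/
theorem exists_pred (h : TwoFour x a b) {i : ℕ} (hi : i ∈ Prod.fst '' blocks x b a) :
    ∃ k, (k, i) ∈ blocks x a b := by
  obtain ⟨⟨i, k'⟩, ⟨s, hs⟩, rfl⟩ := hi
  obtain ⟨z, k, i', hB, hz, hall⟩ := h.exists_runs
  obtain ⟨s', hs', he⟩ := h.four.exists_ge s (i + k' + 1) (z 0 + k 0)
  simp only at hs ⊢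
  have hs'' := isBlock_of_eq hs he
  have hmono : StrictMono z := strictMono_nat_of_lt_succ fun t => by
    have := (hB t).1
    have := hz t
    omega
  have hgr := Nat.findGreatest_spec (P := fun t => z t ≤ s') (Nat.zero_le s') (by omega)
  have hgr' := Nat.findGreatest_is_greatest (P := fun t => z t ≤ s') (n := s')
    (Nat.lt_succ_self _)
  set t := Nat.findGreatest (fun t => z t ≤ s') s'
  clear_value t
  have hlt : s' < z (t + 1) := by
    by_contra hc
    exact hgr' ((hmono.id_le _).trans (not_lt.1 hc)) (not_lt.1 hc)
  have hBt := hB t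
  have hBt' := hB (t + 1)
  rw [hz] at hlt hBt'
  have hbl := isBlock_succ hBt hBt'
  have : s' = z t + k t := by
    obtain ⟨hk, hi, h0, h1, h2, h3⟩ := hBt
    obtain ⟨hi1, -, e0, e1, -, -⟩ := hs''
    have e1' := e1 1 le_rfl hi1
    by_contra hne
    obtain ⟨d, rfl⟩ := Nat.exists_eq_add_of_le hgr
    rcases lt_or_ge d (k t) with hd | hd
    · have := h1 (d + 1) (by omega) hd
      rw [← add_assoc, e1'] at this
      exact h.ne this
    · have := h2 d (by omega) (by omega)
      rw [e0] at this
      exact h.ne this.symm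
  rw [this] at hs''
  have := h.symm.isBlock_unique hbl hs''
  exact ⟨k t, z t, by rw [← this.1]; exact hBt⟩

/-- The graph whose edges are the pairs of successive runs is strongly connected. -/
theorem closed (h : TwoFour x a b) {P : ℕ → Prop}
    (hP : ∀ k i k', (k, i) ∈ blocks x a b → (i, k') ∈ blocks x b a → P k → P k') {k₀ : ℕ}
    (hk₀ : k₀ ∈ Prod.fst '' blocks x a b) (h₀ : P k₀) : ∀ k ∈ Prod.fst '' blocks x a b, P k := by
  obtain ⟨z, k, i, hB, hz, hall⟩ := h.exists_runs
  have hmono : StrictMono z := strictMono_nat_of_lt_succ fun t => by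
    have := (hB t).1
    have := hz t
    omega
  have hfar : ∀ k' ∈ Prod.fst '' blocks x a b, ∀ T, ∃ t ≥ T, k t = k' := by
    rintro _ ⟨⟨k', i'⟩, ⟨s, hs⟩, rfl⟩ T
    simp only at hs ⊢
    obtain ⟨s', hs', he⟩ := h.four.exists_ge s (k' + i' + 1) (z T)
    have hs'' := isBlock_of_eq hs he
    obtain ⟨t, ht⟩ := hall s' ((hmono.monotone (Nat.zero_le T)).trans hs') hs''.2.2.1
      (hs''.2.2.2.1 1 le_rfl hs''.1)
    refine ⟨t, hmono.le_iff_le.1 (by omega), ?_⟩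
    have hBt := hB t
    rw [ht] at hBt
    exact (h.isBlock_unique hBt hs'').1
  obtain ⟨t₀, -, ht₀⟩ := hfar k₀ hk₀ 0
  have hind : ∀ t, P (k (t₀ + t)) := by
    intro t
    induction t with
    | zero => simpa [ht₀] using h₀
    | succ t ih =>
      have hB' := hB (t₀ + t + 1)
      rw [hz] at hB'
      exact hP _ _ _ ⟨_, hB (t₀ + t)⟩ ⟨_, isBlock_succ (hB (t₀ + t)) hB'⟩ ih
  intro k' hk'
  obtain ⟨t, ht, rfl⟩ := hfar k' hk' t₀
  have := hind (t - t₀)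
  rwa [Nat.add_sub_cancel' ht] at this

end TwoFour

/-- The maximal run lengths `κ + 1`, `ι + 1` of `b` and `a`, and the runs adjacent to runs of the
two largest lengths. -/
structure Extremal {S : Type*} (x : ℕ → S) (a b : S) (κ ι k₀ i₀ j j' : ℕ) : Prop where
  max_snd : IsGreatest (Prod.fst '' blocks x a b) (κ + 1)
  max_fst : IsGreatest (Prod.fst '' blocks x b a) (ι + 1)
  pred_snd : (i₀, κ) ∈ blocks x b a
  pred_snd' : (i₀, κ + 1) ∈ blocks x b a
  pred_fst : (k₀, ι) ∈ blocks x a b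
  pred_fst' : (k₀, ι + 1) ∈ blocks x a b
  succ_snd : (κ, j) ∈ blocks x a b
  succ_snd' : (κ + 1, j) ∈ blocks x a b
  succ_fst : (ι, j') ∈ blocks x b a
  succ_fst' : (ι + 1, j') ∈ blocks x b a

namespace TwoFour

variable {S : Type*} {x : ℕ → S} {a b : S}

theorem exists_max (h : TwoFour x a b) : ∃ κ, IsGreatest (Prod.fst '' blocks x a b) (κ + 1) := by
  have hne : (Prod.fst '' blocks x a b).Nonempty := by
    rw [← Set.ncard_pos h.runs_finite]
    have := h.three_le_runs
    omega
  obtain ⟨M, hM⟩ := h.runs_finite.exists_maximalFor id _ hne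
  have hM' : IsGreatest (Prod.fst '' blocks x a b) M :=
    ⟨hM.1, fun k hk => by
      by_contra hc
      exact hc (hM.2 hk (not_le.1 hc).le)⟩
  have := h.three_le_of_isGreatest hM'
  exact ⟨M - 1, by rwa [Nat.sub_add_cancel (by omega)]⟩

theorem exists_extremal (h : TwoFour x a b) :
    ∃ κ ι k₀ i₀ j j', Extremal x a b κ ι k₀ i₀ j j' := by
  obtain ⟨κ, hκ⟩ := h.exists_max
  obtain ⟨ι, hι⟩ := h.symm.exists_max
  obtain ⟨i₀, h1, h2⟩ := h.exists_common_pred hκ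
  obtain ⟨k₀, h3, h4⟩ := h.symm.exists_common_pred hι
  obtain ⟨j, h5, h6⟩ := h.exists_common_succ hκ
  obtain ⟨j', h7, h8⟩ := h.symm.exists_common_succ hι
  exact ⟨κ, ι, k₀, i₀, j, j', hκ, hι, h1, h2, h3, h4, h5, h6, h7, h8⟩

theorem _root_.Extremal.symm {κ ι k₀ i₀ j j' : ℕ} (E : Extremal x a b κ ι k₀ i₀ j j') :
    Extremal x b a ι κ i₀ k₀ j' j :=
  ⟨E.max_fst, E.max_snd, E.pred_fst, E.pred_fst', E.pred_snd, E.pred_snd', E.succ_fst,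
    E.succ_fst', E.succ_snd, E.succ_snd'⟩

theorem deterministic (h : TwoFour x a b) {κ ι k₀ i₀ j j' : ℕ}
    (E : Extremal x a b κ ι k₀ i₀ j j') :
    (∀ k i i', (k, i) ∈ blocks x a b → (k, i') ∈ blocks x a b → k ≠ k₀ → i = i') ∧
      (∀ i, (k₀, i) ∈ blocks x a b → ι ≤ i) ∧ (Prod.fst '' blocks x a b).ncard = 3 := by
  obtain ⟨hfin, h4⟩ := h.blocks_finite
  have h3 := h.three_le_runs
  have hne : (k₀, ι) ≠ (k₀, ι + 1) := by simp
  have himg : ∀ e ∈ ({(k₀, ι), (k₀, ι + 1)} : Set (ℕ × ℕ)),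
      Prod.fst '' (blocks x a b \ {e}) = Prod.fst '' blocks x a b := by
    intro e he
    refine Set.Subset.antisymm (Set.image_mono Set.sdiff_subset) ?_
    rintro _ ⟨q, hq, rfl⟩
    by_cases hqe : q = e
    · subst hqe
      rcases he with rfl | he
      · exact ⟨(k₀, ι + 1), ⟨E.pred_fst', hne.symm⟩, rfl⟩
      · rw [Set.mem_singleton_iff] at he
        subst he
        exact ⟨(k₀, ι), ⟨E.pred_fst, hne⟩, rfl⟩
    · exact ⟨q, ⟨hq, hqe⟩, rfl⟩
  have hcard : ∀ e ∈ ({(k₀, ι), (k₀, ι + 1)} : Set (ℕ × ℕ)),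
      Set.InjOn Prod.fst (blocks x a b \ {e}) ∧ (Prod.fst '' blocks x a b).ncard = 3 := by
    intro e he
    have hmem : e ∈ blocks x a b := by
      rcases he with rfl | he
      · exact E.pred_fst
      · rw [Set.mem_singleton_iff] at he
        subst he
        exact E.pred_fst'
    have h1 := Set.ncard_sdiff_singleton_lt_of_mem hmem hfin
    have hfin' : (blocks x a b \ {e}).Finite := hfin.subset Set.sdiff_subset
    have h2 : (Prod.fst '' (blocks x a b \ {e})).ncard ≤ _ := Set.ncard_image_le hfin'
    rw [himg e he] at h2
    refine ⟨Set.injOn_of_ncard_image_eq ?_ hfin', by omega⟩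
    rw [himg e he]
    omega
  obtain ⟨hi1, hc⟩ := hcard (k₀, ι) (by simp)
  obtain ⟨hi2, -⟩ := hcard (k₀, ι + 1) (by simp)
  refine ⟨fun k i i' hki hki' hk => ?_, fun i hi => ?_, hc⟩
  · exact (Prod.mk.inj (hi1 ⟨hki, by simp [hk]⟩ ⟨hki', by simp [hk]⟩ rfl)).2
  · by_contra hlt
    have := @hi2 (k₀, i) ⟨hi, by simp; omega⟩ (k₀, ι)
      ⟨E.pred_fst, by simp⟩ rfl
    have := (Prod.mk.inj this).2
    omega

/-- Exactly one run length is smaller than the two largest. -/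
theorem exists_unique_lt (h : TwoFour x a b) {κ ι k₀ i₀ j j' : ℕ}
    (E : Extremal x a b κ ι k₀ i₀ j j') :
    ∃ k₁ < κ, k₁ ∈ Prod.fst '' blocks x a b ∧
      ∀ k ∈ Prod.fst '' blocks x a b, k < κ → k = k₁ := by
  have h3 := (h.deterministic E).2.2
  have hκ : κ ∈ Prod.fst '' blocks x a b := ⟨_, E.succ_snd, rfl⟩
  have hsub : ({κ, κ + 1} : Set ℕ) ⊆ Prod.fst '' blocks x a b := by
    rintro k (rfl | rfl)
    exacts [hκ, E.max_snd.1]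
  have hd := Set.ncard_sdiff_add_ncard_of_subset hsub h.runs_finite
  rw [Set.ncard_pair (by omega), h3] at hd
  obtain ⟨k₁, hk₁⟩ := Set.ncard_eq_one.1 (show (Prod.fst '' blocks x a b \ {κ, κ + 1}).ncard = 1
    by omega)
  have hmem : k₁ ∈ Prod.fst '' blocks x a b \ {κ, κ + 1} := by rw [hk₁]; rfl
  have hle := E.max_snd.2 hmem.1
  refine ⟨k₁, ?_, hmem.1, fun k hk hlt => ?_⟩
  · have := hmem.2
    simp only [Set.mem_insert_iff, Set.mem_singleton_iff, not_or] at this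
    omega
  · have : k ∈ Prod.fst '' blocks x a b \ {κ, κ + 1} := ⟨hk, by
      simp only [Set.mem_insert_iff, Set.mem_singleton_iff, not_or]; omega⟩
    rwa [hk₁] at this

end TwoFour

namespace TwoFour

variable {S : Type*} {x : ℕ → S} {a b : S}

theorem eq_of_isBlock {s s' k i : ℕ} (hB : IsBlock x a b s k i) (hB' : IsBlock x a b s' k i)
    {l : ℕ} (hl : l ≤ k + i + 1) : x (s + l) = x (s' + l) := by
  obtain ⟨hk, hi, h0, h1, h2, h3⟩ := hB
  obtain ⟨hk', hi', h0', h1', h2', h3'⟩ := hB'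
  rcases Nat.eq_zero_or_pos l with rfl | hl0
  · rw [add_zero, add_zero, h0, h0']
  · rcases le_or_gt l k with hlk | hlk
    · rw [h1 l hl0 hlk, h1' l hl0 hlk]
    · rcases hl.lt_or_eq with hl | rfl
      · rw [h2 l hlk (by omega), h2' l hlk (by omega)]
      · rw [← add_assoc, ← add_assoc, ← add_assoc, ← add_assoc, h3, h3']

theorem not_start_of_isBlock (h : TwoFour x a b) {s k i l : ℕ} (hB : IsBlock x a b s k i)
    (hl : s < l) (hl' : l < s + k + i) : ¬ (x l = a ∧ x (l + 1) = b) := by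
  rintro ⟨ha, hb⟩
  obtain ⟨hk, hi, h0, h1, h2, h3⟩ := hB
  obtain ⟨d, rfl⟩ := Nat.exists_eq_add_of_lt hl
  by_cases hd : d + 1 ≤ k
  · have := h1 (d + 1) (by omega) hd
    rw [← add_assoc, ha] at this
    exact h.ne this
  · have := h2 (d + 2) (by omega) (by omega)
    rw [show s + (d + 2) = s + d + 1 + 1 by omega, hb] at this
    exact h.ne this.symm

theorem exists_isBlock_add (h : TwoFour x a b) {s k i : ℕ} (hB : IsBlock x a b s k i) :
    ∃ k' i', IsBlock x a b (s + k + i) k' i' := by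
  refine h.exists_block ?_ hB.2.2.2.2.2
  have := hB.2.2.2.2.1 (k + i) (by have := hB.2.1; omega) le_rfl
  rwa [← add_assoc] at this

theorem snd_mem_runs (h : TwoFour x a b) {k i : ℕ} (hki : (k, i) ∈ blocks x a b) :
    i ∈ Prod.fst '' blocks x b a := by
  obtain ⟨s, hB⟩ := hki
  obtain ⟨k', i', hB'⟩ := h.exists_isBlock_add hB
  exact ⟨(i, k'), ⟨_, isBlock_succ hB hB'⟩, rfl⟩

theorem false_of_cyclic (h : TwoFour x a b) {κ ι k₀ i₀ j j' k₁ : ℕ}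
    (E : Extremal x a b κ ι k₀ i₀ j j') (hk₁ : k₁ < κ) (hmem : (k₁, i₀) ∈ blocks x a b)
    (h1 : ∀ k i, (k, i) ∈ blocks x a b → κ ≤ k → ι ≤ i)
    (h2 : ∀ i k, (i, k) ∈ blocks x b a → ι ≤ i → k = k₁)
    (h3 : ∀ i, (k₁, i) ∈ blocks x a b → i = i₀)
    (h4 : ∀ k, (i₀, k) ∈ blocks x b a → κ ≤ k) : False := by
  classical
  set Q : ℕ → Prop := fun s => x s = a ∧ ∀ i < κ, x (s + 1 + i) = b with hQ
  have hQstart : ∀ s, Q s → x s = a ∧ x (s + 1) = b := fun s hs => ⟨hs.1, hs.2 0 (by omega)⟩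
  have hQiff : ∀ s k i, IsBlock x a b s k i → (Q s ↔ κ ≤ k) := by
    intro s k i hB
    constructor
    · intro hs
      by_contra hlt
      have e1 := hs.2 k (by omega)
      have e2 := hB.2.2.2.2.1 (k + 1) (by omega) (by have := hB.2.1; omega)
      rw [show s + 1 + k = s + (k + 1) by omega, e2] at e1
      exact h.ne e1
    · intro hle
      refine ⟨hB.2.2.1, fun l hl => ?_⟩
      rw [add_assoc]
      exact hB.2.2.2.1 _ (by omega) (by omega)
  have hQ4 : (retWords x Q).Finite ∧ (retWords x Q).ncard = 4 := by
    obtain ⟨s, hs⟩ := E.succ_snd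
    have := (hQiff _ _ _ hs).2 le_rfl
    exact h.fst_run_pattern this.1 this.2
  have hex : ∀ s, ∃ p : ℕ × ℕ, Q s → IsBlock x a b s p.1 p.2 := by
    intro s
    by_cases hs : Q s
    · obtain ⟨k, i, hB⟩ := h.exists_block (hQstart s hs).1 (hQstart s hs).2
      exact ⟨(k, i), fun _ => hB⟩
    · exact ⟨(0, 0), fun hc => absurd hc hs⟩
  choose g hg using hex
  have hnext : ∀ q ∈ retPairs Q, κ ≤ (g q.1).1 ∧ IsBlock x a b q.1 (g q.1).1 (g q.1).2 ∧
      IsBlock x a b (q.1 + (g q.1).1 + (g q.1).2) k₁ i₀ ∧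
      q.2 = q.1 + (g q.1).1 + (g q.1).2 + k₁ + i₀ := by
    rintro ⟨s, s'⟩ hq
    have hB := hg s hq.2.1
    generalize g s = p at hB ⊢
    obtain ⟨k, i⟩ := p
    simp only at hB ⊢
    have hk := (hQiff _ _ _ hB).1 hq.2.1
    obtain ⟨k', i', hB'⟩ := h.exists_isBlock_add hB
    obtain rfl := h2 _ _ ⟨_, isBlock_succ hB hB'⟩ (h1 k i ⟨s, hB⟩ hk)
    obtain rfl := h3 _ ⟨_, hB'⟩
    obtain ⟨k'', i'', hB''⟩ := h.exists_isBlock_add hB'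
    have hQ'' := (hQiff _ _ _ hB'').2 (h4 _ ⟨_, isBlock_succ hB' hB''⟩)
    refine ⟨hk, hB, hB', retPairs_unique hq ⟨?_, hq.2.1, hQ'', ?_⟩⟩
    · have := hB.1
      simp only
      omega
    · intro l hl hl' hQl
      simp only at hl hl'
      rcases lt_trichotomy l (s + k + i) with hc | hc | hc
      · exact h.not_start_of_isBlock hB hl hc (hQstart l hQl)
      · rw [hc, hQiff _ _ _ hB'] at hQl
        omega
      · exact h.not_start_of_isBlock hB' hc hl' (hQstart l hQl)
  have hsub : (fun q : ℕ × ℕ => g q.1) '' retPairs Q ⊆ blocks x a b \ {(k₁, i₀)} := by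
    rintro _ ⟨q, hq, rfl⟩
    obtain ⟨e1, e2, -, -⟩ := hnext q hq
    refine ⟨⟨_, e2⟩, fun hc => ?_⟩
    have : (g q.1).1 = k₁ := by rw [show g q.1 = (k₁, i₀) from hc]
    omega
  have hfin : (blocks x a b \ {(k₁, i₀)}).Finite := h.blocks_finite.1.subset Set.sdiff_subset
  have hcount := ncard_image_le_of_determined (I := retPairs Q) (F := fun q : ℕ × ℕ => g q.1)
    (G := fun q : ℕ × ℕ => factorAt x q.1 (q.2 - q.1)) (by
      intro q hq q' hq' he
      obtain ⟨-, e2, e3, e4⟩ := hnext q hq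
      obtain ⟨-, e2', e3', e4'⟩ := hnext q' hq'
      rw [← he] at e2' e3' e4'
      refine factorAt_eq_iff.2 ⟨by omega, fun l hl => ?_⟩
      rcases le_or_gt l ((g q.1).1 + (g q.1).2) with hc | hc
      · exact eq_of_isBlock e2 e2' (by omega)
      · have := eq_of_isBlock e3 e3' (l := l - ((g q.1).1 + (g q.1).2)) (by omega)
        rwa [show q.1 + (g q.1).1 + (g q.1).2 + (l - ((g q.1).1 + (g q.1).2)) = q.1 + l by omega,
          show q'.1 + (g q.1).1 + (g q.1).2 + (l - ((g q.1).1 + (g q.1).2)) = q'.1 + l by omega]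
          at this) (hfin.subset hsub)
  have l1 := Set.ncard_le_ncard hsub hfin
  have l2 := Set.ncard_sdiff_singleton_lt_of_mem hmem h.blocks_finite.1
  have l3 := h.blocks_finite.2
  have l4 : (retWords x Q).ncard ≤ _ := hcount.2
  omega

theorem succ_ge_of_pred_ge (h : TwoFour x a b) {κ ι k₀ i₀ j j' : ℕ}
    (E : Extremal x a b κ ι k₀ i₀ j j') (hk₀ : κ ≤ k₀) {k i : ℕ} (hki : (k, i) ∈ blocks x a b)
    (hk : κ ≤ k) : ι ≤ i := by
  obtain ⟨d1, d2, -⟩ := h.deterministic E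
  have hub : ∀ k i, (k, i) ∈ blocks x a b → k ≤ κ + 1 := fun k i hki => E.max_snd.2 ⟨_, hki, rfl⟩
  have hk₀K := hub _ _ E.pred_fst
  have hj : ι ≤ j := d2 j (by
    rcases (show k₀ = κ ∨ k₀ = κ + 1 by omega) with rfl | rfl
    exacts [E.succ_snd, E.succ_snd'])
  by_cases hkk : k = k₀
  · subst hkk; exact d2 i hki
  · rcases (show k = κ ∨ k = κ + 1 by have := hub _ _ hki; omega) with rfl | rfl
    · rw [d1 _ _ _ hki E.succ_snd hkk]; exact hj
    · rw [d1 _ _ _ hki E.succ_snd' hkk]; exact hj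

theorem false_of_pred_mem_of_not_mem (h : TwoFour x a b) {κ ι k₀ i₀ j j' : ℕ}
    (E : Extremal x a b κ ι k₀ i₀ j j') (hk₀ : κ ≤ k₀) (hi₀ : i₀ < ι) : False := by
  obtain ⟨d1, d2, -⟩ := h.deterministic E
  obtain ⟨d1', d2', -⟩ := h.symm.deterministic E.symm
  obtain ⟨k₁, hk₁, hk₁m, hk₁u⟩ := h.exists_unique_lt E
  obtain ⟨i₁, hi₁, hi₁m, hi₁u⟩ := h.symm.exists_unique_lt E.symm
  have hub' : ∀ i k, (i, k) ∈ blocks x b a → i ≤ ι + 1 := fun k i hki => E.max_fst.2 ⟨_, hki, rfl⟩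
  have hi₀₁ : i₀ = i₁ := hi₁u _ ⟨_, E.pred_snd, rfl⟩ hi₀
  have f1 : ∀ k i, (k, i) ∈ blocks x a b → κ ≤ k → ι ≤ i := fun _ _ hki hk =>
    h.succ_ge_of_pred_ge E hk₀ hki hk
  have f2 : ∀ i k, (i, k) ∈ blocks x b a → ι ≤ i → k = j' := by
    intro i k hik hi
    have hne : i ≠ i₀ := by omega
    rcases (show i = ι ∨ i = ι + 1 by have := hub' _ _ hik; omega) with rfl | rfl
    · exact d1' _ _ _ hik E.succ_fst hne
    · exact d1' _ _ _ hik E.succ_fst' hne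
  have hj' : j' < κ := by
    by_contra hc
    have := h.closed (P := fun k => κ ≤ k)
      (fun k i k' hki hik hk => by rw [f2 _ _ hik (f1 _ _ hki hk)]; omega)
      ⟨_, E.succ_snd, rfl⟩ le_rfl k₁ hk₁m
    omega
  have hj'K : j' ∈ Prod.fst '' blocks x a b := h.symm.snd_mem_runs E.succ_fst
  obtain rfl := hk₁u j' hj'K hj'
  have f3 : ∀ i, (j', i) ∈ blocks x a b → i = i₀ := by
    intro i hi
    by_contra hne
    have hall : ∀ k' i', (k', i') ∈ blocks x a b → ι ≤ i' := by
      intro k' i' hki'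
      rcases lt_or_ge k' κ with hlt | hge
      · obtain rfl := hk₁u k' ⟨_, hki', rfl⟩ hlt
        obtain rfl := d1 _ _ _ hi hki' (by omega)
        by_contra hc
        exact hne ((hi₁u i (h.snd_mem_runs hi) (by omega)).trans hi₀₁.symm)
      · exact f1 _ _ hki' hge
    obtain ⟨k', hk'⟩ := h.exists_pred ⟨_, E.pred_snd, rfl⟩
    have := hall _ _ hk'
    omega
  obtain ⟨⟨k', i'⟩, hki', rfl⟩ := hj'K
  obtain rfl := f3 _ hki'
  exact h.false_of_cyclic E hj' hki' f1 f2 f3 d2'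

end TwoFour

namespace TwoFour

variable {S : Type*} {x : ℕ → S} {a b : S}

theorem elim (h : TwoFour x a b) : False := by
  obtain ⟨κ, ι, k₀, i₀, j, j', E⟩ := h.exists_extremal
  obtain ⟨k₁, hk₁, hk₁m, hk₁u⟩ := h.exists_unique_lt E
  rcases le_or_gt κ k₀ with hk₀ | hk₀ <;> rcases le_or_gt ι i₀ with hi₀ | hi₀
  · have := h.closed (P := fun k => κ ≤ k) (fun k i k' hki hik hk =>
      h.symm.succ_ge_of_pred_ge E.symm hi₀ hik (h.succ_ge_of_pred_ge E hk₀ hki hk))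
      ⟨_, E.succ_snd, rfl⟩ le_rfl k₁ hk₁m
    omega
  · exact h.false_of_pred_mem_of_not_mem E hk₀ hi₀
  · exact h.symm.false_of_pred_mem_of_not_mem E.symm hi₀ hk₀
  · obtain ⟨d1, d2, -⟩ := h.deterministic E
    obtain ⟨d1', d2', -⟩ := h.symm.deterministic E.symm
    obtain ⟨i₁, hi₁, hi₁m, hi₁u⟩ := h.symm.exists_unique_lt E.symm
    have hsucc : ∀ k i, (k, i) ∈ blocks x a b → κ ≤ k → i = j := by
      intro k i hki hk
      have hne : k ≠ k₀ := by omega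
      have hle : k ≤ κ + 1 := E.max_snd.2 ⟨_, hki, rfl⟩
      rcases (show k = κ ∨ k = κ + 1 by omega) with rfl | rfl
      · exact d1 _ _ _ hki E.succ_snd hne
      · exact d1 _ _ _ hki E.succ_snd' hne
    rcases lt_or_ge j ι with hj | hj
    · have hj₀ : j = i₀ := (hi₁u j (h.snd_mem_runs E.succ_snd) hj).trans
        (hi₁u i₀ ⟨_, E.pred_snd, rfl⟩ hi₀).symm
      have := h.closed (P := fun k => κ ≤ k) (fun k i k' hki hik hk => d2' _ (by
        rwa [hsucc _ _ hki hk, hj₀] at hik)) ⟨_, E.succ_snd, rfl⟩ le_rfl k₁ hk₁m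
      omega
    · obtain ⟨k, hk⟩ := h.exists_pred ⟨_, E.pred_snd, rfl⟩
      rcases lt_or_ge k κ with hlt | hge
      · have e1 := hk₁u k ⟨_, hk, rfl⟩ hlt
        have e2 := hk₁u k₀ ⟨_, E.pred_fst, rfl⟩ hk₀
        rw [e1, ← e2] at hk
        have := d2 _ hk
        omega
      · have := hsucc _ _ hk hge
        omega

end TwoFour

/-- Any return word is realized by occurrences arbitrarily far to the right. -/
theorem PropertyR.exists_ge {u : ℕ → A} {m : ℕ} (hu : PropertyR u (m + 1)) (t l N : ℕ) :
    ∃ s ≥ N, ∀ i < l, u (s + i) = u (t + i) := by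
  refine exists_ge_of_recurrent (fun l => ?_) t l N
  have hfac : IsFactor u (factorAt u 0 l) := ⟨0, occursAt_factorAt_iff.2 fun _ _ => rfl⟩
  obtain ⟨hfin, hcard⟩ := hu _ hfac
  have hne : (returnWords u (factorAt u 0 l)).Nonempty := by
    rw [← Set.ncard_pos hfin]; omega
  obtain ⟨v, j, k, hjk, -, hk, -⟩ := hne
  refine ⟨k, by omega, fun i hi => ?_⟩
  simpa using occursAt_factorAt_iff.1 hk i hi

theorem occursAt_of_eq {u : ℕ → A} {w : List A} {j k : ℕ} (h : OccursAt u w j)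
    (he : ∀ i < w.length, u (k + i) = u (j + i)) : OccursAt u w k :=
  (factorAt_eq_iff.2 ⟨rfl, he⟩).trans h

theorem PropertyR.exists_occursAt_ge {u : ℕ → A} {m : ℕ} (hu : PropertyR u (m + 1)) {w : List A}
    (hw : IsFactor u w) (N : ℕ) : ∃ s ≥ N, OccursAt u w s := by
  obtain ⟨j, hj⟩ := hw
  obtain ⟨s, hs, he⟩ := hu.exists_ge j w.length N
  exact ⟨s, hs, occursAt_of_eq hj he⟩

theorem eq_of_occursAt {u : ℕ → A} {w : List A} {j k : ℕ} (h : OccursAt u w j)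
    (h' : OccursAt u w k) : ∀ i < w.length, u (k + i) = u (j + i) := by
  have := factorAt_eq_iff.1 (h'.trans h.symm)
  exact this.2

/-- A sequence `x` of states visited at the positions `pos` of `u`, the state `v` being marked by
an occurrence of the word `W v` of length `n`; the future is determined by what is read in `u`. -/
structure Coding {V : Type*} (u : ℕ → A) (W : V → List A) (n s₀ : ℕ) (x : ℕ → V) (pos : ℕ → ℕ) :
    Prop where
  len : ∀ v, (W v).length = n
  occ : ∀ τ, OccursAt u (W (x τ)) (pos τ)
  surj : ∀ τ₀ s, s₀ ≤ s → OccursAt u (W (x τ₀)) s → ∃ τ, x τ = x τ₀ ∧ pos τ = s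
  ge : ∀ τ, s₀ ≤ pos τ
  mono : Monotone pos
  strict : ∀ τ τ', x τ = x τ' → τ < τ' → pos τ < pos τ'
  flow : ∀ τ τ', x τ = x τ' →
    (∀ i < pos (τ + 1) - pos τ + n, u (pos τ' + i) = u (pos τ + i)) →
      x (τ' + 1) = x (τ + 1) ∧ pos (τ' + 1) = pos τ' + (pos (τ + 1) - pos τ)

/-- The label of the transition at time `τ`: source, word read, and target. -/
def label {V : Type*} (u : ℕ → A) (x : ℕ → V) (pos : ℕ → ℕ) (τ : ℕ) : V × List A × V :=
  (x τ, factorAt u (pos τ) (pos (τ + 1) - pos τ), x (τ + 1))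

namespace Coding

variable {V : Type*} {u : ℕ → A} {W : V → List A} {n s₀ : ℕ} {x : ℕ → V} {pos : ℕ → ℕ}

theorem flow_iter (C : Coding u W n s₀ x pos) {τ τ' : ℕ} (k : ℕ) (hx : x τ = x τ')
    (h : ∀ i < pos (τ + k) - pos τ + n, u (pos τ' + i) = u (pos τ + i)) :
    ∀ i ≤ k, x (τ' + i) = x (τ + i) ∧ pos (τ' + i) = pos τ' + (pos (τ + i) - pos τ) := by
  intro i
  induction i with
  | zero => exact fun _ => ⟨hx.symm, by simp⟩
  | succ i ih =>
    intro hi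
    obtain ⟨h1, h2⟩ := ih (by omega)
    have m1 := C.mono (show τ ≤ τ + i by omega)
    have m2 := C.mono (show τ + i ≤ τ + i + 1 by omega)
    have m3 := C.mono (show τ + i + 1 ≤ τ + k by omega)
    have := C.flow (τ + i) (τ' + i) h1.symm (fun l hl => by
      have := h (pos (τ + i) - pos τ + l) (by omega)
      rw [h2, add_assoc, this]
      congr 1
      omega)
    refine ⟨this.1, ?_⟩
    rw [← add_assoc, ← add_assoc, this.2, h2]
    omega

theorem label_iter (C : Coding u W n s₀ x pos) {τ τ' : ℕ} (k : ℕ) (hx : x τ = x τ')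
    (h : ∀ i < k, label u x pos (τ + i) = label u x pos (τ' + i)) :
    x (τ + k) = x (τ' + k) ∧
      factorAt u (pos τ) (pos (τ + k) - pos τ) = factorAt u (pos τ') (pos (τ' + k) - pos τ') := by
  induction k with
  | zero => simpa [factorAt] using hx
  | succ k ih =>
    obtain ⟨h1, h2⟩ := ih fun i hi => h i (by omega)
    have hk := h k (by omega)
    simp only [label, Prod.mk.injEq] at hk
    obtain ⟨-, h3, h4⟩ := hk
    refine ⟨h4, ?_⟩
    have split : ∀ τ, factorAt u (pos τ) (pos (τ + (k + 1)) - pos τ) =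
        factorAt u (pos τ) (pos (τ + k) - pos τ) ++
          factorAt u (pos (τ + k)) (pos (τ + k + 1) - pos (τ + k)) := by
      intro τ
      have m1 := C.mono (show τ ≤ τ + k by omega)
      have m2 := C.mono (show τ + k ≤ τ + k + 1 by omega)
      rw [show pos (τ + (k + 1)) - pos τ =
        (pos (τ + k) - pos τ) + (pos (τ + k + 1) - pos (τ + k)) by rw [← add_assoc]; omega,
        factorAt_add, Nat.add_sub_cancel' m1]
    rw [split, split, h2, h3]

theorem time_eq (C : Coding u W n s₀ x pos) {τ τ' : ℕ} (hx : x τ = x τ') (hp : pos τ = pos τ') :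
    τ = τ' := by
  rcases lt_trichotomy τ τ' with h | h | h
  · have := C.strict _ _ hx h; omega
  · exact h
  · have := C.strict _ _ hx.symm h; omega

/-- Return words of `U` are read between successive times satisfying `N`, if these times mark the
occurrences of `U`. -/
theorem returnWords_eq (C : Coding u W n s₀ x pos) (hu : PropertyR u 4) {U : List A}
    {N : ℕ → Prop} (h1 : ∀ t, N t → OccursAt u U (pos t))
    (h2 : ∀ s ≥ s₀, OccursAt u U s → ∃ t, N t ∧ pos t = s)
    (h3 : ∀ t t', N t → N t' → x t = x t') :
    returnWords u U =
      (fun q : ℕ × ℕ => factorAt u (pos q.1) (pos q.2 - pos q.1)) '' retPairs N := by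
  have hlt : ∀ {t t'}, pos t < pos t' → t < t' := fun h => by
    by_contra hc
    have := C.mono (not_lt.1 hc)
    omega
  ext v
  constructor
  · rintro ⟨j, k, hjk, hj, hk, hbet, rfl⟩
    obtain ⟨j', hj', he⟩ := hu.exists_ge j (k - j + U.length) s₀
    have tr : ∀ l ≤ k - j, OccursAt u U (j' + l) ↔ OccursAt u U (j + l) := by
      intro l hl
      have : ∀ i < U.length, u (j' + l + i) = u (j + l + i) := fun i hi => by
        rw [add_assoc, add_assoc]; exact he _ (by omega)
      exact ⟨fun h => occursAt_of_eq h fun i hi => (this i hi).symm,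
        fun h => occursAt_of_eq h this⟩
    obtain ⟨t, ht, htp⟩ := h2 j' hj' (by simpa using (tr 0 (by omega)).2 (by simpa using hj))
    obtain ⟨t', ht', htp'⟩ := h2 (j' + (k - j)) (by omega)
      ((tr _ le_rfl).2 (by rwa [Nat.add_sub_cancel' hjk.le]))
    refine ⟨(t, t'), ⟨hlt (t := t) (t' := t') (by omega), ht, ht', fun l hl hl' hNl => ?_⟩, ?_⟩
    · have e1 := C.strict _ _ (h3 _ _ ht hNl) hl
      have e2 := C.strict _ _ (h3 _ _ hNl ht') hl'
      have e3 := (tr (pos l - j') (by omega)).1 (by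
        rw [Nat.add_sub_cancel' (by omega)]; exact h1 l hNl)
      exact hbet _ (by omega) (by omega) e3
    · simp only
      rw [htp, htp', Nat.add_sub_cancel_left]
      exact factorAt_eq_iff.2 ⟨rfl, fun i hi => he i (by omega)⟩
  · rintro ⟨⟨t, t'⟩, ⟨htt, ht, ht', hbet⟩, rfl⟩
    simp only at htt ht ht' hbet ⊢
    have hpos := C.strict _ _ (h3 _ _ ht ht') htt
    refine ⟨pos t, pos t', hpos, h1 _ ht, h1 _ ht', fun l hl hl' hol => ?_, rfl⟩
    obtain ⟨t'', h4, rfl⟩ := h2 l ((C.ge t).trans hl.le) hol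
    exact hbet _ (hlt hl) (hlt hl') h4

end Coding

namespace Coding

variable {V : Type*} {u : ℕ → A} {W : V → List A} {n s₀ : ℕ} {x : ℕ → V} {pos : ℕ → ℕ}

section restrict

variable {D : Set V} {φ : ℕ → ℕ}

theorem next_le {f : ℕ → V} (hφ : StrictMono φ) (hD : ∀ τ, f τ ∈ D ↔ ∃ σ, φ σ = τ) {σ τ : ℕ}
    (h : φ σ < τ) (hτ : f τ ∈ D) : φ (σ + 1) ≤ τ := by
  obtain ⟨ρ, rfl⟩ := (hD τ).1 hτ
  exact hφ.monotone (hφ.lt_iff_lt.1 h)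

theorem next_eq {f : ℕ → V} (hφ : StrictMono φ) (hD : ∀ τ, f τ ∈ D ↔ ∃ σ, φ σ = τ) {σ σ' : ℕ}
    (h : ∀ i ≤ φ (σ + 1) - φ σ, f (φ σ' + i) = f (φ σ + i)) :
    φ (σ' + 1) = φ σ' + (φ (σ + 1) - φ σ) := by
  have hlt := hφ (Nat.lt_add_one σ)
  have hlt' := hφ (Nat.lt_add_one σ')
  have hm := h _ le_rfl
  rw [Nat.add_sub_cancel' hlt.le] at hm
  have hle : φ (σ' + 1) ≤ φ σ' + (φ (σ + 1) - φ σ) :=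
    next_le hφ hD (by omega) (by rw [hm]; exact (hD _).2 ⟨_, rfl⟩)
  have hge := h (φ (σ' + 1) - φ σ') (by omega)
  rw [Nat.add_sub_cancel' hlt'.le] at hge
  have := next_le hφ hD (σ := σ) (τ := φ σ + (φ (σ' + 1) - φ σ')) (by omega)
    (by rw [← hge]; exact (hD _).2 ⟨_, rfl⟩)
  omega

/-- The coding induced on the times at which the state is in `D`. -/
theorem restrict (C : Coding u W n s₀ x pos) (hφ : StrictMono φ)
    (hD : ∀ τ, x τ ∈ D ↔ ∃ σ, φ σ = τ) : Coding u W n s₀ (x ∘ φ) (pos ∘ φ) where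
  len := C.len
  occ τ := C.occ _
  surj τ₀ s hs ho := by
    obtain ⟨τ, h1, h2⟩ := C.surj _ s hs ho
    obtain ⟨σ, rfl⟩ := (hD τ).1 (by rw [h1]; exact (hD _).2 ⟨_, rfl⟩)
    exact ⟨σ, h1, h2⟩
  ge τ := C.ge _
  mono := C.mono.comp hφ.monotone
  strict τ τ' h1 h2 := C.strict _ _ h1 (hφ h2)
  flow σ σ' hx h := by
    have hlt := hφ (Nat.lt_add_one σ)
    have hm : φ σ + (φ (σ + 1) - φ σ) = φ (σ + 1) := Nat.add_sub_cancel' hlt.le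
    have hit := C.flow_iter (φ (σ + 1) - φ σ) hx (by rw [hm]; exact h)
    have hnext := next_eq hφ hD fun i hi => (hit i hi).1
    have := hit _ le_rfl
    rw [← hnext, hm] at this
    exact this

theorem label_restrict (C : Coding u W n s₀ x pos) (hφ : StrictMono φ)
    (hD : ∀ τ, x τ ∈ D ↔ ∃ σ, φ σ = τ)
    (hdet : ∀ τ τ', x τ = x τ' → x τ ∉ D → label u x pos τ = label u x pos τ') {σ ρ : ℕ}
    (h : label u x pos (φ σ) = label u x pos (φ ρ)) :
    label u (x ∘ φ) (pos ∘ φ) σ = label u (x ∘ φ) (pos ∘ φ) ρ := by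
  have hlt := hφ (Nat.lt_add_one σ)
  have hm : φ σ + (φ (σ + 1) - φ σ) = φ (σ + 1) := Nat.add_sub_cancel' hlt.le
  have hlab : ∀ i < φ (σ + 1) - φ σ,
      label u x pos (φ σ + i) = label u x pos (φ ρ + i) := by
    intro i
    induction i with
    | zero => exact fun _ => h
    | succ i ih =>
      intro hi
      have h1 := ih (by omega)
      refine hdet _ _ (congrArg (fun p => p.2.2) h1) fun hmem => ?_
      have := next_le hφ hD (show φ σ < φ σ + (i + 1) by omega) hmem
      omega
  have hx : x (φ σ) = x (φ ρ) := congrArg Prod.fst h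
  have hit : ∀ i ≤ φ (σ + 1) - φ σ, x (φ ρ + i) = x (φ σ + i) := fun i hi =>
    (C.label_iter i hx fun l hl => hlab l (by omega)).1.symm
  have hnext := next_eq hφ hD hit
  have := C.label_iter _ hx hlab
  rw [← hnext, hm] at this
  simp only [label, Function.comp, Prod.mk.injEq]
  exact ⟨hx, this.2, this.1⟩

theorem exists_enumeration {f : ℕ → V} (h : ∀ T, ∃ τ ≥ T, f τ ∈ D) :
    ∃ φ : ℕ → ℕ, StrictMono φ ∧ ∀ τ, f τ ∈ D ↔ ∃ σ, φ σ = τ := by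
  have hinf : {τ | f τ ∈ D}.Infinite := by
    refine Set.infinite_of_not_bddAbove ?_
    rintro ⟨B, hB⟩
    obtain ⟨τ, hτ, hm⟩ := h (B + 1)
    have := hB hm
    omega
  refine ⟨Nat.nth fun τ => f τ ∈ D, Nat.nth_strictMono hinf, fun τ => ?_⟩
  have := Set.ext_iff.1 (Nat.range_nth_of_infinite hinf) τ
  exact this.symm

end restrict

/-- If the transitions are determined by source and target, then every factor of the state
sequence has four return words. -/
theorem fourfold (C : Coding u W n s₀ x pos) (hu : PropertyR u 4)
    (hdet : ∀ τ τ', x τ = x τ' → x (τ + 1) = x (τ' + 1) → label u x pos τ = label u x pos τ') :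
    Fourfold x := by
  intro t m
  set N : ℕ → Prop := fun s => ∀ i ≤ m, x (s + i) = x (t + i) with hN
  set U := factorAt u (pos t) (pos (t + m) - pos t + n) with hU
  have hNx : ∀ s, N s → x s = x t := fun s hs => by simpa using hs 0 (Nat.zero_le _)
  have hlab : ∀ s s' k, (∀ i ≤ k, x (s + i) = x (s' + i)) →
      factorAt u (pos s) (pos (s + k) - pos s) = factorAt u (pos s') (pos (s' + k) - pos s') := by
    intro s s' k hk
    exact (C.label_iter k (by simpa using hk 0 (Nat.zero_le _)) fun i hi =>
      hdet _ _ (hk i hi.le) (hk (i + 1) hi)).2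
  have hocc : ∀ {s s' k k'}, x (s + k) = x (s' + k') →
      factorAt u (pos s) (pos (s + k) - pos s) = factorAt u (pos s') (pos (s' + k') - pos s') →
      ∀ i < pos (s' + k') - pos s' + n, u (pos s + i) = u (pos s' + i) := by
    intro s s' k k' hx hw i hi
    obtain ⟨hl, he⟩ := factorAt_eq_iff.1 hw
    have m1 := C.mono (Nat.le_add_right s k)
    have m2 := C.mono (Nat.le_add_right s' k')
    rcases lt_or_ge i (pos (s' + k') - pos s') with hc | hc
    · exact he i (by omega)
    · have o1 := C.occ (s + k)
      rw [hx] at o1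
      have := eq_of_occursAt (C.occ (s' + k')) o1 (i - (pos (s' + k') - pos s'))
        (by rw [C.len]; omega)
      rwa [show pos (s + k) + (i - (pos (s' + k') - pos s')) = pos s + i by omega,
        show pos (s' + k') + (i - (pos (s' + k') - pos s')) = pos s' + i by omega] at this
  have hret := C.returnWords_eq hu (U := U) (N := N)
    (fun s hs => occursAt_factorAt_iff.2 (hocc (hs m le_rfl) (hlab s t m hs)))
    (fun s hs ho => by
      have ho' := occursAt_factorAt_iff.1 ho
      obtain ⟨τ, h1, rfl⟩ := C.surj t s hs (occursAt_of_eq (C.occ t) fun i hi =>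
        ho' i (by rw [C.len] at hi; omega))
      exact ⟨τ, fun i hi => (C.flow_iter m h1.symm ho' i hi).1, rfl⟩)
    fun s s' hs hs' => (hNx s hs).trans (hNx s' hs').symm
  have hfac := hu U ⟨pos t, occursAt_factorAt_iff.2 fun _ _ => rfl⟩
  rw [hret] at hfac
  have d1 : ∀ q ∈ retPairs N, ∀ q' ∈ retPairs N,
      factorAt x q.1 (q.2 - q.1) = factorAt x q'.1 (q'.2 - q'.1) →
      factorAt u (pos q.1) (pos q.2 - pos q.1) =
        factorAt u (pos q'.1) (pos q'.2 - pos q'.1) := by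
    intro q hq q' hq' he
    obtain ⟨hl, he⟩ := factorAt_eq_iff.1 he
    have := hlab q.1 q'.1 (q.2 - q.1) fun i hi => by
      rcases hi.lt_or_eq with hi | rfl
      · exact he i hi
      · rw [Nat.add_sub_cancel' hq.1.le, hl, Nat.add_sub_cancel' hq'.1.le, hNx _ hq.2.2.1,
          hNx _ hq'.2.2.1]
    rwa [Nat.add_sub_cancel' hq.1.le, hl, Nat.add_sub_cancel' hq'.1.le] at this
  have d2 : ∀ q ∈ retPairs N, ∀ q' ∈ retPairs N,
      factorAt u (pos q.1) (pos q.2 - pos q.1) =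
        factorAt u (pos q'.1) (pos q'.2 - pos q'.1) →
      factorAt x q.1 (q.2 - q.1) = factorAt x q'.1 (q'.2 - q'.1) := by
    intro q hq q' hq' he
    have e1 : q.1 + (q.2 - q.1) = q.2 := Nat.add_sub_cancel' hq.1.le
    have e2 : q'.1 + (q'.2 - q'.1) = q'.2 := Nat.add_sub_cancel' hq'.1.le
    have hx1 : x q.1 = x q'.1 := (hNx _ hq.2.1).trans (hNx _ hq'.2.1).symm
    have hx2 : x q.2 = x q'.2 := (hNx _ hq.2.2.1).trans (hNx _ hq'.2.2.1).symm
    have hag := hocc (s := q'.1) (s' := q.1) (k := q'.2 - q'.1) (k' := q.2 - q.1)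
      (by rw [e1, e2, hx2]) (by rw [e1, e2, he])
    have hit := C.flow_iter (q.2 - q.1) hx1 hag
    have hl := (factorAt_eq_iff.1 he).1
    have hend := hit _ le_rfl
    rw [e1] at hend
    have hm := C.mono hq'.1.le
    have ht := C.time_eq (τ := q'.1 + (q.2 - q.1)) (τ' := q'.2) (hend.1.trans hx2) (by omega)
    exact factorAt_eq_iff.2 ⟨by omega, fun i hi => (hit i hi.le).1.symm⟩
  have c1 := ncard_image_le_of_determined d2 hfac.1
  have c2 := ncard_image_le_of_determined d1 c1.1
  refine ⟨c1.1, ?_⟩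
  have l1 : (retWords x N).ncard ≤ _ := c1.2
  have l2 : _ ≤ (retWords x N).ncard := c2.2
  omega

end Coding

namespace Coding

variable {V : Type*} {u : ℕ → A} {W : V → List A} {n s₀ : ℕ} {x : ℕ → V} {pos : ℕ → ℕ}

theorem returnWords_state (C : Coding u W n s₀ x pos) (hu : PropertyR u 4) (τ₀ : ℕ) :
    returnWords u (W (x τ₀)) = (fun q : ℕ × ℕ => factorAt u (pos q.1) (pos q.2 - pos q.1)) ''
      retPairs fun τ => x τ = x τ₀ :=
  C.returnWords_eq hu (fun t ht => by rw [← ht]; exact C.occ t) (fun s hs ho => C.surj τ₀ s hs ho)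
    fun _ _ ht ht' => ht.trans ht'.symm

/-- The transitions with source `v`. -/
def outLabels (u : ℕ → A) (x : ℕ → V) (pos : ℕ → ℕ) (v : V) : Set (V × List A × V) :=
  label u x pos '' {τ | x τ = v}

theorem label_eq_of_target_eq {v : V} (hfin : (outLabels u x pos v).Finite)
    (hcard : (outLabels u x pos v).ncard ≤ 2) {τ₁ τ₂ : ℕ} (h₁ : x τ₁ = v) (h₂ : x τ₂ = v)
    (hne : x (τ₁ + 1) ≠ x (τ₂ + 1)) {τ τ' : ℕ} (h : x τ = v) (h' : x τ' = v)
    (he : x (τ + 1) = x (τ' + 1)) : label u x pos τ = label u x pos τ' := by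
  have hlne : label u x pos τ₁ ≠ label u x pos τ₂ := fun hc =>
    hne (congrArg (fun p => p.2.2) hc)
  have hsub : {label u x pos τ₁, label u x pos τ₂} ⊆ outLabels u x pos v := by
    rintro _ (rfl | rfl)
    exacts [⟨τ₁, h₁, rfl⟩, ⟨τ₂, h₂, rfl⟩]
  have heq := Set.eq_of_subset_of_ncard_le hsub (by rwa [Set.ncard_pair hlne]) hfin
  have m : label u x pos τ ∈ outLabels u x pos v := ⟨τ, h, rfl⟩
  have m' : label u x pos τ' ∈ outLabels u x pos v := ⟨τ', h', rfl⟩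
  rw [← heq] at m m'
  have tgt : ∀ {ρ ρ'}, label u x pos ρ = label u x pos ρ' → x (ρ + 1) = x (ρ' + 1) :=
    fun hc => congrArg (fun p => p.2.2) hc
  rcases m with m | m <;> rcases m' with m' | m'
  · rw [m, m']
  · exact absurd ((tgt m).symm.trans (he.trans (tgt m'))) hne
  · exact absurd ((tgt m').symm.trans (he.symm.trans (tgt m))) hne
  · rw [m, m']

theorem exists_switch {v v' : V} (hne : v ≠ v') (two : ∀ τ, x τ = v ∨ x τ = v')
    (h : ∃ τ, x τ = v) (inf : ∀ T, ∃ τ ≥ T, x τ = v') : ∃ τ, x τ = v ∧ x (τ + 1) = v' := by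
  classical
  obtain ⟨t, ht⟩ := h
  have hex : ∃ k, x (t + k) = v' := by
    obtain ⟨s, hs, h⟩ := inf t
    exact ⟨s - t, by rwa [Nat.add_sub_cancel' hs]⟩
  have h0 : Nat.find hex ≠ 0 := fun h0 => by
    have := Nat.find_spec hex
    rw [h0, add_zero, ht] at this
    exact hne this
  obtain ⟨k, hk⟩ := Nat.exists_eq_succ_of_ne_zero h0
  refine ⟨t + k, (two _).resolve_right (Nat.find_min hex (by omega)), ?_⟩
  have := Nat.find_spec hex
  rwa [hk] at this

/-- It is impossible that exactly one of the two states has a loop. -/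
theorem false_of_one_loop (C : Coding u W n s₀ x pos) (hu : PropertyR u 4) {v v' : V}
    (hne : v ≠ v') (two : ∀ τ, x τ = v ∨ x τ = v') (inf' : ∀ T, ∃ τ ≥ T, x τ = v')
    (hfin : (outLabels u x pos v).Finite) (hcard : (outLabels u x pos v).ncard ≤ 2)
    (hfin' : (outLabels u x pos v').Finite) (hcard' : (outLabels u x pos v').ncard ≤ 2)
    {τ₀ : ℕ} (hl : x τ₀ = v) (hl' : x (τ₀ + 1) = v) (hno : ∀ τ, x τ = v' → x (τ + 1) = v) :
    False := by
  classical
  obtain ⟨τ₁, h₁, h₁'⟩ := exists_switch hne two ⟨τ₀, hl⟩ inf'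
  have hdet : ∀ {τ τ'}, x τ = v → x τ' = v → x (τ + 1) = x (τ' + 1) →
      label u x pos τ = label u x pos τ' := fun h h' he =>
    label_eq_of_target_eq hfin hcard hl h₁ (by rw [hl', h₁']; exact hne) h h' he
  have hret := C.returnWords_state hu τ₀
  rw [hl] at hret
  have hfour := (hu (W v) ⟨pos τ₀, by rw [← hl]; exact C.occ _⟩).2
  rw [hret] at hfour
  let F : ℕ × ℕ → Option (V × List A × V) := fun q =>
    if x (q.1 + 1) = v then none else some (label u x pos (q.1 + 1))
  have hstep : ∀ q ∈ retPairs fun τ => x τ = v, x (q.1 + 1) = v → q.2 = q.1 + 1 :=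
    fun q hq h => retPairs_unique (s := q.1) hq
      ⟨Nat.lt_add_one _, hq.2.1, h, fun l h1 h2 => by simp only at h1 h2; omega⟩
  have hstep' : ∀ q ∈ retPairs fun τ => x τ = v, x (q.1 + 1) ≠ v → q.2 = q.1 + 2 := by
    refine fun q hq h => retPairs_unique (s := q.1) hq ⟨by simp, hq.2.1,
      hno _ ((two _).resolve_left h), fun l h1 h2 => ?_⟩
    simp only at h1 h2
    obtain rfl : l = q.1 + 1 := by omega
    exact h
  have hsub : F '' (retPairs fun τ => x τ = v) ⊆
      insert none (some '' outLabels u x pos v') := by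
    rintro _ ⟨q, hq, rfl⟩
    simp only [F]
    split_ifs with hc
    · exact Or.inl rfl
    · exact Or.inr ⟨_, ⟨q.1 + 1, (two _).resolve_left hc, rfl⟩, rfl⟩
  have hfinS : (insert none (some '' outLabels u x pos v')).Finite := (hfin'.image _).insert _
  have hcount := ncard_image_le_of_determined (I := retPairs fun τ => x τ = v) (F := F)
    (G := fun q : ℕ × ℕ => factorAt u (pos q.1) (pos q.2 - pos q.1)) (by
      intro q hq q' hq' he
      simp only [F] at he
      split_ifs at he with h1 h2 h2
      · rw [hstep q hq h1, hstep q' hq' h2]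
        exact congrArg (fun p => p.2.1) (hdet hq.2.1 hq'.2.1 (h1.trans h2.symm))
      · rw [hstep' q hq h1, hstep' q' hq' h2]
        refine (C.label_iter 2 (hq.2.1.trans hq'.2.1.symm) fun i hi => ?_).2
        interval_cases i
        · exact hdet hq.2.1 hq'.2.1
            (((two _).resolve_left h1).trans ((two _).resolve_left h2).symm)
        · exact Option.some_injective _ he) (hfinS.subset hsub)
  have l1 := Set.ncard_le_ncard hsub hfinS
  have l2 := Set.ncard_insert_le none (some '' outLabels u x pos v')
  have l3 : (some '' outLabels u x pos v').ncard ≤ _ := Set.ncard_image_le hfin'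
  have l4 := hcount.2
  omega

theorem exists_pair_of_ncard_le_two {α : Type*} {s : Set α} (hne : s.Nonempty) (hf : s.Finite)
    (h : s.ncard ≤ 2) : ∃ a b, s = {a, b} := by
  have := (Set.ncard_pos hf).2 hne
  rcases (show s.ncard = 1 ∨ s.ncard = 2 by omega) with h | h
  · obtain ⟨a, rfl⟩ := Set.ncard_eq_one.1 h
    exact ⟨a, a, by simp⟩
  · obtain ⟨a, b, -, rfl⟩ := Set.ncard_eq_two.1 h
    exact ⟨a, b, rfl⟩

/-- The words read in the transitions with source `v`. -/
def outWords (u : ℕ → A) (x : ℕ → V) (pos : ℕ → ℕ) (v : V) : Set (List A) :=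
  (fun τ => factorAt u (pos τ) (pos (τ + 1) - pos τ)) '' {τ | x τ = v}

theorem exists_outWords {v : V} (hex : ∃ τ, x τ = v) (hfin : (outLabels u x pos v).Finite)
    (hcard : (outLabels u x pos v).ncard ≤ 2) : ∃ v₁ v₂, outWords u x pos v = {v₁, v₂} := by
  obtain ⟨τ, hτ⟩ := hex
  have := ncard_image_le_of_determined (I := {τ | x τ = v}) (F := label u x pos)
    (G := fun τ => factorAt u (pos τ) (pos (τ + 1) - pos τ))
    (fun τ _ τ' _ h => congrArg (fun p => p.2.1) h) hfin
  exact exists_pair_of_ncard_le_two ⟨_, ⟨τ, hτ, rfl⟩⟩ this.1 (this.2.trans hcard)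

theorem returnWords_eq_of_alternating (C : Coding u W n s₀ x pos) (hu : PropertyR u 4) {v v' : V}
    (hne : v ≠ v') (hex : ∃ τ, x τ = v) (h1 : ∀ τ, x τ = v → x (τ + 1) = v')
    (h2 : ∀ τ, x τ = v' → x (τ + 1) = v) {v₁ v₂ v₃ v₄ : List A}
    (hO : outWords u x pos v = {v₁, v₂}) (hO' : outWords u x pos v' = {v₃, v₄}) :
    returnWords u (W v) = {v₁ ++ v₃, v₁ ++ v₄, v₂ ++ v₃, v₂ ++ v₄} := by
  classical
  obtain ⟨τ₀, hl⟩ := hex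
  have hret := C.returnWords_state hu τ₀
  rw [hl] at hret
  have hfour := (hu (W v) ⟨pos τ₀, by rw [← hl]; exact C.occ _⟩).2
  refine Set.eq_of_subset_of_ncard_le ?_ ?_ (Set.toFinite _)
  · rw [hret]
    rintro _ ⟨q, hq, rfl⟩
    have hx1 := h1 _ hq.2.1
    have hq2 : q.2 = q.1 + 1 + 1 := by
      refine retPairs_unique (s := q.1) hq ⟨by simp, hq.2.1, h2 _ hx1, fun l h1 h2 => ?_⟩
      simp only at h1 h2
      obtain rfl : l = q.1 + 1 := by omega
      exact fun hc => hne (hc.symm.trans hx1)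
    have m1 := C.mono (show q.1 ≤ q.1 + 1 by omega)
    have m2 := C.mono (show q.1 + 1 ≤ q.1 + 1 + 1 by omega)
    have w1 : factorAt u (pos q.1) (pos (q.1 + 1) - pos q.1) ∈ outWords u x pos v :=
      ⟨_, hq.2.1, rfl⟩
    have w2 : factorAt u (pos (q.1 + 1)) (pos (q.1 + 1 + 1) - pos (q.1 + 1)) ∈
        outWords u x pos v' := ⟨_, hx1, rfl⟩
    rw [hO] at w1
    rw [hO'] at w2
    simp only [hq2]
    rw [show pos (q.1 + 1 + 1) - pos q.1 = (pos (q.1 + 1) - pos q.1) +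
      (pos (q.1 + 1 + 1) - pos (q.1 + 1)) by omega, factorAt_add, Nat.add_sub_cancel' m1]
    rcases w1 with w1 | w1 <;> rcases w2 with w2 | w2 <;> rw [w1, w2] <;> simp
  · rw [hfour]
    have l1 := Set.ncard_insert_le (v₁ ++ v₃) {v₁ ++ v₄, v₂ ++ v₃, v₂ ++ v₄}
    have l2 := Set.ncard_insert_le (v₁ ++ v₄) {v₂ ++ v₃, v₂ ++ v₄}
    have l3 := Set.ncard_insert_le (v₂ ++ v₃) {v₂ ++ v₄}
    rw [Set.ncard_singleton] at l3
    omega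

/-- The structure of return words in the two-state case. -/
theorem exists_factorization (C : Coding u W n s₀ x pos) (hu : PropertyR u 4) {v v' : V}
    (hne : v ≠ v') (two : ∀ τ, x τ = v ∨ x τ = v') (inf : ∀ T, ∃ τ ≥ T, x τ = v)
    (inf' : ∀ T, ∃ τ ≥ T, x τ = v')
    (hfin : (outLabels u x pos v).Finite) (hcard : (outLabels u x pos v).ncard ≤ 2)
    (hfin' : (outLabels u x pos v').Finite) (hcard' : (outLabels u x pos v').ncard ≤ 2) :
    ∃ v₁ v₂ v₃ v₄ : List A,
      returnWords u (W v) = {v₁ ++ v₃, v₁ ++ v₄, v₂ ++ v₃, v₂ ++ v₄} ∧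
      returnWords u (W v') = {v₃ ++ v₁, v₃ ++ v₂, v₄ ++ v₁, v₄ ++ v₂} := by
  obtain ⟨τ₁, -, hτ₁⟩ := inf 0
  obtain ⟨τ₂, -, hτ₂⟩ := inf' 0
  have two' : ∀ τ, x τ = v' ∨ x τ = v := fun τ => (two τ).symm
  by_cases hloop : ∃ τ, x τ = v ∧ x (τ + 1) = v
  · obtain ⟨τ, h1, h2⟩ := hloop
    by_cases hloop' : ∃ τ, x τ = v' ∧ x (τ + 1) = v'
    · obtain ⟨τ', h1', h2'⟩ := hloop'
      obtain ⟨ρ, hρ, hρ'⟩ := exists_switch hne two ⟨_, hτ₁⟩ inf'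
      obtain ⟨ρ', hρ₁, hρ₁'⟩ := exists_switch hne.symm two' ⟨_, hτ₂⟩ inf
      have hdet : ∀ σ σ', x σ = x σ' → x (σ + 1) = x (σ' + 1) →
          label u x pos σ = label u x pos σ' := by
        intro σ σ' he he'
        rcases two σ with h | h
        · exact label_eq_of_target_eq hfin hcard h1 hρ (by rw [h2, hρ']; exact hne) h
            (he.symm.trans h) he'
        · exact label_eq_of_target_eq hfin' hcard' h1' hρ₁ (by rw [h2', hρ₁']; exact hne.symm) h
            (he.symm.trans h) he'
      exact (TwoFour.elim ⟨hne, two, C.fourfold hu hdet, ⟨τ, h1, h2⟩, ⟨τ', h1', h2'⟩⟩).elim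
    · push Not at hloop'
      exact (C.false_of_one_loop hu hne two inf' hfin hcard hfin' hcard' h1 h2 fun τ h =>
        (two _).resolve_right (hloop' τ h)).elim
  · push Not at hloop
    have hstep := fun τ h => (two (τ + 1)).resolve_left (hloop τ h)
    by_cases hloop' : ∃ τ, x τ = v' ∧ x (τ + 1) = v'
    · obtain ⟨τ', h1', h2'⟩ := hloop'
      exact (C.false_of_one_loop hu hne.symm two' inf hfin' hcard' hfin hcard h1' h2' hstep).elim
    · push Not at hloop'
      have hstep' := fun τ h => (two (τ + 1)).resolve_right (hloop' τ h)
      obtain ⟨v₁, v₂, hO⟩ := exists_outWords ⟨_, hτ₁⟩ hfin hcard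
      obtain ⟨v₃, v₄, hO'⟩ := exists_outWords ⟨_, hτ₂⟩ hfin' hcard'
      exact ⟨v₁, v₂, v₃, v₄,
        C.returnWords_eq_of_alternating hu hne ⟨_, hτ₁⟩ hstep hstep' hO hO',
        C.returnWords_eq_of_alternating hu hne.symm ⟨_, hτ₂⟩ hstep' hstep hO' hO⟩

end Coding

theorem occursAt_cons_iff {u : ℕ → A} {w : List A} {a : A} {s : ℕ} :
    OccursAt u (a :: w) s ↔ u s = a ∧ OccursAt u w (s + 1) := by
  rw [OccursAt, OccursAt, List.length_cons, add_comm, factorAt_add, factorAt_one]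
  simp

theorem occursAt_concat_iff {u : ℕ → A} {w : List A} {b : A} {s : ℕ} :
    OccursAt u (w ++ [b]) s ↔ OccursAt u w s ∧ u (s + w.length) = b := by
  rw [OccursAt, OccursAt, List.length_append, List.length_singleton, factorAt_add, factorAt_one]
  simp

/-- The one-letter extensions of `w`: `inl a` stands for `aw` and `inr b` for `wb`. -/
def extWord (w : List A) : A ⊕ A → List A
  | .inl a => a :: w
  | .inr b => w ++ [b]

/-- The extensions of `w` met in `u`, where `p` enumerates the occurrences of `w`: at even times the
right extension of an occurrence, at odd times the left extension of the next one. -/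
def extState (u : ℕ → A) (w : List A) (p : ℕ → ℕ) (τ : ℕ) : A ⊕ A :=
  if τ % 2 = 0 then .inr (u (p (τ / 2) + w.length)) else .inl (u (p (τ / 2 + 1) - 1))

/-- The positions of the extensions of `w` listed by `extState`. -/
def extPos (p : ℕ → ℕ) (τ : ℕ) : ℕ := if τ % 2 = 0 then p (τ / 2) else p (τ / 2 + 1) - 1

section extState

variable {u : ℕ → A} {w : List A} {p : ℕ → ℕ}

theorem extState_even (t : ℕ) : extState u w p (2 * t) = .inr (u (p t + w.length)) := by
  simp [extState]

theorem extState_odd (t : ℕ) : extState u w p (2 * t + 1) = .inl (u (p (t + 1) - 1)) := by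
  simp [extState, show (2 * t + 1) % 2 = 1 by omega, show (2 * t + 1) / 2 = t by omega]

theorem extPos_even (t : ℕ) : extPos p (2 * t) = p t := by
  simp [extPos]

theorem extPos_odd (t : ℕ) : extPos p (2 * t + 1) = p (t + 1) - 1 := by
  simp [extPos, show (2 * t + 1) % 2 = 1 by omega, show (2 * t + 1) / 2 = t by omega]

theorem extState_eq_imp {τ τ' : ℕ} (h : extState u w p τ = extState u w p τ') :
    τ % 2 = τ' % 2 := by
  rcases Nat.mod_two_eq_zero_or_one τ with h1 | h1 <;>
    rcases Nat.mod_two_eq_zero_or_one τ' with h2 | h2 <;> simp_all [extState]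

theorem next_occurrence_eq {t t' : ℕ} (hp : StrictMono p)
    (ho : ∀ s, OccursAt u w s ↔ ∃ t, p t = s)
    (h : ∀ i < p (t + 1) - p t + w.length, u (p t' + i) = u (p t + i)) :
    p (t' + 1) = p t' + (p (t + 1) - p t) := by
  have tr : ∀ l ≤ p (t + 1) - p t, OccursAt u w (p t + l) ↔ OccursAt u w (p t' + l) := by
    intro l hl
    have : ∀ i < w.length, u (p t' + l + i) = u (p t + l + i) := fun i hi => by
      rw [add_assoc, add_assoc]; exact h _ (by omega)
    exact ⟨fun h => occursAt_of_eq h this, fun h => occursAt_of_eq h fun i hi => (this i hi).symm⟩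
  have h1 := hp (Nat.lt_add_one t)
  have h2 := hp (Nat.lt_add_one t')
  obtain ⟨r, hr⟩ := (ho _).1 ((tr _ le_rfl).1 (by
    rw [Nat.add_sub_cancel' h1.le]; exact (ho _).2 ⟨_, rfl⟩))
  have h3 : p (t' + 1) ≤ p r := hp.monotone (hp.lt_iff_lt.1 (show p t' < p r by omega))
  obtain ⟨r', hr'⟩ := (ho _).1 ((tr (p (t' + 1) - p t') (by omega)).2 (by
    rw [Nat.add_sub_cancel' h2.le]; exact (ho _).2 ⟨_, rfl⟩))
  have h4 : p (t + 1) ≤ p r' := hp.monotone (hp.lt_iff_lt.1 (show p t < p r' by omega))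
  omega

theorem coding_ext (hp : StrictMono p) (ho : ∀ s, OccursAt u w s ↔ ∃ t, p t = s) :
    Coding u (extWord w) (w.length + 1) (p 0) (extState u w p) (extPos p) := by
  have hocc : ∀ t, OccursAt u w (p t) := fun t => (ho _).2 ⟨t, rfl⟩
  have hlt : ∀ t, p t < p (t + 1) := fun t => hp (Nat.lt_add_one t)
  have par : ∀ τ, ∃ t, τ = 2 * t ∨ τ = 2 * t + 1 := fun τ => ⟨τ / 2, by omega⟩
  have hmono : Monotone (extPos p) := by
    refine monotone_nat_of_le_succ fun τ => ?_
    obtain ⟨t, rfl | rfl⟩ := par τ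
    · rw [extPos_even, extPos_odd]
      have := hlt t
      omega
    · rw [extPos_odd, show 2 * t + 1 + 1 = 2 * (t + 1) by ring, extPos_even]
      omega
  refine ⟨?_, ?_, ?_, ?_, hmono, ?_, ?_⟩
  · rintro (a | b) <;> simp [extWord]
  · intro τ
    obtain ⟨t, rfl | rfl⟩ := par τ
    · rw [extPos_even, extState_even]
      exact occursAt_concat_iff.2 ⟨hocc t, rfl⟩
    · rw [extPos_odd, extState_odd]
      refine occursAt_cons_iff.2 ⟨rfl, ?_⟩
      have := hlt t
      rw [Nat.sub_add_cancel (by omega)]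
      exact hocc _
  · intro τ₀ s hs h
    obtain ⟨t, rfl | rfl⟩ := par τ₀
    · rw [extState_even] at h ⊢
      obtain ⟨h1, h2⟩ := occursAt_concat_iff.1 h
      obtain ⟨r, rfl⟩ := (ho _).1 h1
      exact ⟨2 * r, by rw [extState_even, h2], extPos_even r⟩
    · rw [extState_odd] at h ⊢
      obtain ⟨h1, h2⟩ := occursAt_cons_iff.1 h
      obtain ⟨r, hr⟩ := (ho _).1 h2
      obtain ⟨r, rfl⟩ : ∃ r', r = r' + 1 := ⟨r - 1, by
        have : r ≠ 0 := by rintro rfl; omega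
        omega⟩
      exact ⟨2 * r + 1, by rw [extState_odd, hr, Nat.add_sub_cancel, h1],
        by rw [extPos_odd, hr, Nat.add_sub_cancel]⟩
  · intro τ
    have := hmono (Nat.zero_le τ)
    rwa [show extPos p 0 = p 0 from extPos_even 0] at this
  · intro τ τ' h hlt'
    have hpar := extState_eq_imp h
    obtain ⟨t, rfl | rfl⟩ := par τ <;> obtain ⟨t', rfl | rfl⟩ := par τ'
    · rw [extPos_even, extPos_even]
      exact hp (by omega)
    · omega
    · omega
    · rw [extPos_odd, extPos_odd]
      have := hp (show t + 1 < t' + 1 by omega)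
      have := hlt t
      omega
  · intro τ τ' h he
    have hpar := extState_eq_imp h
    obtain ⟨t, rfl | rfl⟩ := par τ <;> obtain ⟨t', rfl | rfl⟩ := par τ'
    · have h1 := hlt t
      have h2 := hlt t'
      simp only [extPos_even, extPos_odd, extState_odd] at he ⊢
      have hn := next_occurrence_eq hp ho fun i hi => he i (by omega)
      have := he (p (t + 1) - 1 - p t) (by omega)
      rw [show p t' + (p (t + 1) - 1 - p t) = p (t' + 1) - 1 by omega,
        show p t + (p (t + 1) - 1 - p t) = p (t + 1) - 1 by omega] at this
      exact ⟨by rw [this], by omega⟩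
    · omega
    · omega
    · have h1 := hlt t
      have h2 := hlt t'
      simp only [show ∀ t, 2 * t + 1 + 1 = 2 * (t + 1) from fun t => by ring, extPos_even,
        extPos_odd, extState_even] at he ⊢
      have := he (w.length + 1) (by omega)
      rw [show p (t' + 1) - 1 + (w.length + 1) = p (t' + 1) + w.length by omega,
        show p (t + 1) - 1 + (w.length + 1) = p (t + 1) + w.length by omega] at this
      exact ⟨by rw [this], by omega⟩

end extState

theorem exists_concentrated {V : Type*} {S : Finset V} (hne : S.Nonempty) {f : V → ℕ}
    (h1 : ∀ v ∈ S, 1 ≤ f v) (hs : ∑ v ∈ S, f v ≤ S.card + 2) :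
    (∃ v ∈ S, f v ≤ 3 ∧ ∀ z ∈ S, z ≠ v → f z = 1) ∨
      ∃ v ∈ S, ∃ v' ∈ S, v ≠ v' ∧ f v ≤ 2 ∧ f v' ≤ 2 ∧
        ∀ z ∈ S, z ≠ v → z ≠ v' → f z = 1 := by
  classical
  have hg : ∑ v ∈ S, (f v - 1) ≤ 2 := by
    have : ∑ v ∈ S, f v = ∑ v ∈ S, (f v - 1) + ∑ v ∈ S, 1 := by
      rw [← Finset.sum_add_distrib]
      exact Finset.sum_congr rfl fun v hv => by have := h1 v hv; omega
    rw [Finset.sum_const, smul_eq_mul, mul_one] at this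
    omega
  have sub : ∀ U ⊆ S, ∑ v ∈ U, (f v - 1) ≤ 2 := fun U hU =>
    (Finset.sum_le_sum_of_subset hU).trans hg
  by_cases hall : ∀ v ∈ S, f v = 1
  · obtain ⟨v, hv⟩ := hne
    exact .inl ⟨v, hv, by rw [hall v hv]; omega, fun z hz _ => hall z hz⟩
  push Not at hall
  obtain ⟨v, hv, hfv⟩ := hall
  have e1 := h1 v hv
  by_cases hv' : ∀ z ∈ S, z ≠ v → f z = 1
  · have := sub {v} (by simpa using hv)
    rw [Finset.sum_singleton] at this
    exact .inl ⟨v, hv, by omega, hv'⟩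
  push Not at hv'
  obtain ⟨v', hv', hne', hfv'⟩ := hv'
  have e2 := h1 v' hv'
  have h2 := sub {v, v'} (by simp [Finset.insert_subset_iff, hv, hv'])
  rw [Finset.sum_pair hne'.symm] at h2
  refine .inr ⟨v, hv, v', hv', hne'.symm, by omega, by omega, fun z hz hzv hzv' => ?_⟩
  have e3 := h1 z hz
  have h3 := sub {z, v, v'} (by simp [Finset.insert_subset_iff, hv, hv', hz])
  rw [Finset.sum_insert (by simp [hzv, hzv']), Finset.sum_pair hne'.symm] at h3
  omega

namespace Coding

variable {V : Type*} {u : ℕ → A} {W : V → List A} {n s₀ : ℕ} {x : ℕ → V} {pos : ℕ → ℕ}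

theorem exists_state_ge (C : Coding u W n s₀ x pos) (hu : PropertyR u 4) (τ₀ T : ℕ) :
    ∃ τ ≥ T, x τ = x τ₀ := by
  obtain ⟨s, hs, ho⟩ := hu.exists_occursAt_ge ⟨_, C.occ τ₀⟩ (max s₀ (pos T + 1))
  obtain ⟨τ, h1, h2⟩ := C.surj τ₀ s (le_of_max_le_left hs) ho
  refine ⟨τ, ?_, h1⟩
  by_contra hc
  have := C.mono (not_le.1 hc).le
  have := le_of_max_le_right hs
  omega

theorem ncard_outLabels_restrict_le (C : Coding u W n s₀ x pos) {D : Set V} {φ : ℕ → ℕ}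
    (hφ : StrictMono φ) (hD : ∀ τ, x τ ∈ D ↔ ∃ σ, φ σ = τ)
    (hdet : ∀ τ τ', x τ = x τ' → x τ ∉ D → label u x pos τ = label u x pos τ') {v : V}
    (hfin : (outLabels u x pos v).Finite) :
    (outLabels u (x ∘ φ) (pos ∘ φ) v).Finite ∧
      (outLabels u (x ∘ φ) (pos ∘ φ) v).ncard ≤ (outLabels u x pos v).ncard := by
  have hsub : (fun σ => label u x pos (φ σ)) '' {σ | (x ∘ φ) σ = v} ⊆ outLabels u x pos v := by
    rintro _ ⟨σ, hσ, rfl⟩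
    exact ⟨φ σ, hσ, rfl⟩
  have := ncard_image_le_of_determined (F := fun σ => label u x pos (φ σ))
    (G := label u (x ∘ φ) (pos ∘ φ)) (I := {σ | (x ∘ φ) σ = v})
    (fun σ _ ρ _ h => C.label_restrict hφ hD hdet h) (hfin.subset hsub)
  exact ⟨this.1, this.2.trans (Set.ncard_le_ncard hsub hfin)⟩

theorem false_of_one_branching (C : Coding u W n s₀ x pos) (hu : PropertyR u 4) {τ₀ : ℕ}
    (hfin : (outLabels u x pos (x τ₀)).Finite) (hcard : (outLabels u x pos (x τ₀)).ncard ≤ 3)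
    (hdet : ∀ τ τ', x τ = x τ' → x τ ≠ x τ₀ → label u x pos τ = label u x pos τ') : False := by
  obtain ⟨φ, hφ, hD⟩ := exists_enumeration (f := x) (D := {x τ₀}) (C.exists_state_ge hu τ₀)
  have C' := C.restrict hφ hD
  have hx : ∀ σ, (x ∘ φ) σ = x τ₀ := fun σ => (hD _).2 ⟨σ, rfl⟩
  obtain ⟨hfin', hcard'⟩ := C.ncard_outLabels_restrict_le hφ hD hdet hfin
  have hret := C'.returnWords_state hu 0
  simp only [hx] at hret
  have hsub : returnWords u (W (x τ₀)) ⊆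
      (fun ℓ => ℓ.2.1) '' outLabels u (x ∘ φ) (pos ∘ φ) (x τ₀) := by
    rw [hret]
    rintro _ ⟨q, hq, rfl⟩
    have : q.2 = q.1 + 1 :=
      retPairs_unique (s := q.1) hq ⟨by simp, trivial, trivial, fun l h1 h2 => by
        simp only at h1 h2; omega⟩
    exact ⟨_, ⟨q.1, hx _, rfl⟩, by simp only [label, this]⟩
  have h4 := (hu _ ⟨_, C.occ τ₀⟩).2
  have l1 := Set.ncard_le_ncard hsub (hfin'.image _)
  have l2 := Set.ncard_image_le (f := fun ℓ : V × List A × V => ℓ.2.1) hfin'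
  omega

theorem exists_two_states [Finite V] (C : Coding u W n s₀ x pos) (hu : PropertyR u 4)
    (hfin : (Set.range (label u x pos)).Finite)
    (hcard : (Set.range (label u x pos)).ncard ≤ (Set.range x).ncard + 2) :
    ∃ τ τ', ∃ v₁ v₂ v₃ v₄ : List A,
      returnWords u (W (x τ)) = {v₁ ++ v₃, v₁ ++ v₄, v₂ ++ v₃, v₂ ++ v₄} ∧
      returnWords u (W (x τ')) = {v₃ ++ v₁, v₃ ++ v₂, v₄ ++ v₁, v₄ ++ v₂} := by
  classical
  have hfinO : ∀ v, (outLabels u x pos v).Finite := fun v =>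
    hfin.subset (Set.image_subset_range _ _)
  have hX : (Set.range x).Finite := Set.toFinite _
  have hsum : (Set.range (label u x pos)).ncard =
      ∑ v ∈ hX.toFinset, (outLabels u x pos v).ncard := by
    rw [Set.ncard_eq_toFinset_card _ hfin, Finset.card_eq_sum_card_fiberwise (f := Prod.fst)
      (t := hX.toFinset)]
    · refine Finset.sum_congr rfl fun v _ => ?_
      rw [Set.ncard_eq_toFinset_card _ (hfinO v)]
      congr 1
      ext ℓ
      simp only [Finset.mem_filter, Set.Finite.mem_toFinset, outLabels, Set.mem_range,
        Set.mem_image, Set.mem_ofPred_eq]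
      constructor
      · rintro ⟨⟨τ, rfl⟩, h⟩
        exact ⟨τ, h, rfl⟩
      · rintro ⟨τ, h, rfl⟩
        exact ⟨⟨τ, rfl⟩, h⟩
    · intro ℓ hℓ
      obtain ⟨τ, rfl⟩ := hfin.mem_toFinset.1 hℓ
      simp [label]
  have hdet : ∀ τ τ', x τ = x τ' → (outLabels u x pos (x τ)).ncard = 1 →
      label u x pos τ = label u x pos τ' := fun τ τ' h h1 =>
    (Set.ncard_le_one (hfinO _)).1 h1.le _ ⟨τ, rfl, rfl⟩ _ ⟨τ', h.symm, rfl⟩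
  rcases exists_concentrated (S := hX.toFinset) ⟨x 0, by simp⟩
      (f := fun v => (outLabels u x pos v).ncard)
      (fun v hv => by
        obtain ⟨τ, rfl⟩ := hX.mem_toFinset.1 hv
        exact (Set.ncard_pos (hfinO _)).2 ⟨_, τ, rfl, rfl⟩)
      (by rw [← hsum, ← Set.ncard_eq_toFinset_card _ hX]; exact hcard) with
    ⟨v, hv, h3, h1⟩ | ⟨v, hv, v', hv', hne, h2, h2', h1⟩
  · obtain ⟨τ₀, rfl⟩ := hX.mem_toFinset.1 hv
    exact (C.false_of_one_branching hu (hfinO _) h3 fun τ τ' h hn =>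
      hdet τ τ' h (h1 _ (by simp) hn)).elim
  · obtain ⟨τ₀, rfl⟩ := hX.mem_toFinset.1 hv
    obtain ⟨τ₁, rfl⟩ := hX.mem_toFinset.1 hv'
    obtain ⟨φ, hφ, hD⟩ := exists_enumeration (f := x) (D := {x τ₀, x τ₁}) fun T => by
      obtain ⟨τ, hτ, h⟩ := C.exists_state_ge hu τ₀ T
      exact ⟨τ, hτ, .inl h⟩
    have C' := C.restrict hφ hD
    have hdetD : ∀ τ τ', x τ = x τ' → x τ ∉ ({x τ₀, x τ₁} : Set V) →
        label u x pos τ = label u x pos τ' := fun τ τ' h hn =>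
      hdet τ τ' h (h1 _ (by simp) (fun hc => hn (.inl hc)) fun hc => hn (.inr hc))
    obtain ⟨f1, c1⟩ := C.ncard_outLabels_restrict_le hφ hD hdetD (hfinO (x τ₀))
    obtain ⟨f2, c2⟩ := C.ncard_outLabels_restrict_le hφ hD hdetD (hfinO (x τ₁))
    obtain ⟨σ₀, hσ₀⟩ := (hD τ₀).1 (.inl rfl)
    obtain ⟨σ₁, hσ₁⟩ := (hD τ₁).1 (.inr rfl)
    refine ⟨τ₀, τ₁, C'.exists_factorization hu hne (fun σ => (hD _).2 ⟨σ, rfl⟩) ?_ ?_ f1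
      (c1.trans h2) f2 (c2.trans h2')⟩
    · rw [← hσ₀]
      exact C'.exists_state_ge hu σ₀
    · rw [← hσ₁]
      exact C'.exists_state_ge hu σ₁

end Coding

section extState

variable {u : ℕ → A} {w : List A} {p : ℕ → ℕ}

theorem label_even_eq (hp : StrictMono p) (ho : ∀ s, OccursAt u w s ↔ ∃ t, p t = s) {t t' : ℕ}
    (h : factorAt u (p t) (p (t + 1) - p t) = factorAt u (p t') (p (t' + 1) - p t')) :
    label u (extState u w p) (extPos p) (2 * t) = label u (extState u w p) (extPos p) (2 * t') := by
  obtain ⟨hl, he⟩ := factorAt_eq_iff.1 h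
  have h1 := hp (Nat.lt_add_one t)
  have h2 := hp (Nat.lt_add_one t')
  have hag : ∀ i < p (t + 1) - p t + w.length, u (p t + i) = u (p t' + i) := fun i hi => by
    rcases lt_or_ge i (p (t + 1) - p t) with hc | hc
    · exact he i hc
    · have := eq_of_occursAt ((ho _).2 ⟨t' + 1, rfl⟩) ((ho _).2 ⟨t + 1, rfl⟩)
        (i - (p (t + 1) - p t)) (by omega)
      rwa [show p (t + 1) + (i - (p (t + 1) - p t)) = p t + i by omega,
        show p (t' + 1) + (i - (p (t + 1) - p t)) = p t' + i by omega] at this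
  simp only [label, extState_even, extState_odd, extPos_even, extPos_odd, Prod.mk.injEq]
  refine ⟨by rw [hag _ (by omega)], factorAt_eq_iff.2 ⟨by omega, fun i hi => hag i (by omega)⟩, ?_⟩
  have := hag (p (t + 1) - 1 - p t) (by omega)
  rw [show p t' + (p (t + 1) - 1 - p t) = p (t' + 1) - 1 by omega,
    show p t + (p (t + 1) - 1 - p t) = p (t + 1) - 1 by omega] at this
  rw [this]

theorem label_odd_eq (hp : StrictMono p) {t t' : ℕ}
    (h : u (p (t + 1) - 1) = u (p (t' + 1) - 1))
    (h' : u (p (t + 1) + w.length) = u (p (t' + 1) + w.length)) :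
    label u (extState u w p) (extPos p) (2 * t + 1) =
      label u (extState u w p) (extPos p) (2 * t' + 1) := by
  have h1 := hp (Nat.lt_add_one t)
  have h2 := hp (Nat.lt_add_one t')
  simp only [label, show ∀ t, 2 * t + 1 + 1 = 2 * (t + 1) from fun t => by ring, extState_even,
    extState_odd, extPos_even, extPos_odd, h, h',
    show p (t + 1) - (p (t + 1) - 1) = 1 by omega,
    show p (t' + 1) - (p (t' + 1) - 1) = 1 by omega, factorAt_one]

theorem ncard_range_label_le [Finite A] (hu : PropertyR u 4) (hp : StrictMono p)
    (ho : ∀ s, OccursAt u w s ↔ ∃ t, p t = s) :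
    (Set.range (label u (extState u w p) (extPos p))).Finite ∧
      (Set.range (label u (extState u w p) (extPos p))).ncard ≤ 4 + (extPairs u w).ncard := by
  have hlt : ∀ t, p t < p (t + 1) := fun t => hp (Nat.lt_add_one t)
  have hocc : ∀ t, OccursAt u w (p t) := fun t => (ho _).2 ⟨t, rfl⟩
  obtain ⟨hfin, hcard⟩ := hu w ⟨_, hocc 0⟩
  have s1 : (fun t => factorAt u (p t) (p (t + 1) - p t)) '' Set.univ ⊆ returnWords u w := by
    rintro _ ⟨t, -, rfl⟩
    refine ⟨_, _, hlt t, hocc t, hocc _, fun l h1 h2 hl => ?_, rfl⟩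
    obtain ⟨r, rfl⟩ := (ho l).1 hl
    have := hp.lt_iff_lt.1 h1
    have := hp.lt_iff_lt.1 h2
    omega
  have s2 : (fun t => (u (p (t + 1) - 1), u (p (t + 1) + w.length))) '' Set.univ ⊆
      extPairs u w := by
    rintro _ ⟨t, -, rfl⟩
    refine ⟨p (t + 1) - 1, occursAt_cons_iff.2 ⟨rfl, occursAt_concat_iff.2 ?_⟩⟩
    have := hlt t
    rw [Nat.sub_add_cancel (by omega)]
    exact ⟨hocc _, rfl⟩
  have i1 := ncard_image_le_of_determined
    (G := fun t => label u (extState u w p) (extPos p) (2 * t))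
    (fun t _ t' _ h => label_even_eq hp ho h) (hfin.subset s1)
  have i2 := ncard_image_le_of_determined
    (G := fun t => label u (extState u w p) (extPos p) (2 * t + 1))
    (fun t _ t' _ h => label_odd_eq hp (congrArg Prod.fst h) (congrArg Prod.snd h))
    ((Set.toFinite _).subset s2)
  have l1 := Set.ncard_le_ncard s1 hfin
  have l2 := Set.ncard_le_ncard s2 (Set.toFinite _)
  have hsub : Set.range (label u (extState u w p) (extPos p)) ⊆
      (fun t => label u (extState u w p) (extPos p) (2 * t)) '' Set.univ ∪
        (fun t => label u (extState u w p) (extPos p) (2 * t + 1)) '' Set.univ := by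
    rintro _ ⟨τ, rfl⟩
    obtain ⟨t, rfl | rfl⟩ : ∃ t, τ = 2 * t ∨ τ = 2 * t + 1 := ⟨τ / 2, by omega⟩
    exacts [.inl ⟨t, trivial, rfl⟩, .inr ⟨t, trivial, rfl⟩]
  have hf := i1.1.union i2.1
  refine ⟨hf.subset hsub, (Set.ncard_le_ncard hsub hf).trans ?_⟩
  refine (Set.ncard_union_le _ _).trans ?_
  have m1 := i1.2
  have m2 := i2.2
  omega

theorem ncard_ext_le_ncard_range [Finite A] (hu : PropertyR u 4)
    (ho : ∀ s, OccursAt u w s ↔ ∃ t, p t = s) :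
    (leftExt u w).ncard + (rightExt u w).ncard ≤ (Set.range (extState u w p)).ncard := by
  rw [← Set.ncard_image_of_injective (leftExt u w) Sum.inl_injective,
    ← Set.ncard_image_of_injective (rightExt u w) Sum.inr_injective,
    ← Set.ncard_union_eq (by
      rw [Set.disjoint_left]
      rintro _ ⟨a, -, rfl⟩ ⟨b, -, h⟩
      cases h)]
  refine Set.ncard_le_ncard ?_ (Set.toFinite _)
  rintro _ (⟨a, ha, rfl⟩ | ⟨b, hb, rfl⟩)
  · obtain ⟨s, hs, h⟩ := hu.exists_occursAt_ge ha (p 0)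
    obtain ⟨h1, h2⟩ := occursAt_cons_iff.1 h
    obtain ⟨r, hr⟩ := (ho _).1 h2
    have : r ≠ 0 := by rintro rfl; omega
    refine ⟨2 * (r - 1) + 1, ?_⟩
    rw [extState_odd, Nat.sub_add_cancel (by omega), hr, Nat.add_sub_cancel, h1]
  · obtain ⟨s, h⟩ := hb
    obtain ⟨h1, h2⟩ := occursAt_concat_iff.1 h
    obtain ⟨r, rfl⟩ := (ho _).1 h1
    exact ⟨2 * r, by rw [extState_even, h2]⟩

end extState

/-- If `u` satisfies `R_4` and `w` is a weak bispecial factor of `u`,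
then there are factors `w₁, w₂ ∈ A w ∪ w A` and words `v₁, v₂, v₃, v₄` with
`R(w₁) = {v₁v₃, v₁v₄, v₂v₃, v₂v₄}` and `R(w₂) = {v₃v₁, v₃v₂, v₄v₁, v₄v₂}`. -/
theorem weakBispecial_structure_R4 [Fintype A] (u : ℕ → A) (h4 : PropertyR u 4)
    (w : List A) (hwb : WeakBispecial u w) :
    ∃ w₁ w₂ v₁ v₂ v₃ v₄ : List A,
      IsFactor u w₁ ∧ IsFactor u w₂ ∧
      ((∃ a : A, w₁ = a :: w) ∨ (∃ a : A, w₁ = w ++ [a])) ∧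
      ((∃ a : A, w₂ = a :: w) ∨ (∃ a : A, w₂ = w ++ [a])) ∧
      returnWords u w₁ = {v₁ ++ v₃, v₁ ++ v₄, v₂ ++ v₃, v₂ ++ v₄} ∧
      returnWords u w₂ = {v₃ ++ v₁, v₃ ++ v₂, v₄ ++ v₁, v₄ ++ v₂} := by
  obtain ⟨hw, hneg⟩ := hwb
  obtain ⟨p, hp, ho⟩ := Coding.exists_enumeration (f := id) (D := {s | OccursAt u w s})
    (h4.exists_occursAt_ge hw)
  have C := coding_ext hp ho
  obtain ⟨hfin, hle⟩ := ncard_range_label_le h4 hp ho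
  have hge := ncard_ext_le_ncard_range h4 ho
  obtain ⟨τ, τ', v₁, v₂, v₃, v₄, h, h'⟩ := C.exists_two_states h4 hfin (by
    rw [bilateralOrder] at hneg
    omega)
  have form : ∀ v, (∃ a : A, extWord w v = a :: w) ∨ ∃ a : A, extWord w v = w ++ [a] := by
    rintro (a | b)
    exacts [.inl ⟨a, rfl⟩, .inr ⟨b, rfl⟩]
  exact ⟨_, _, v₁, v₂, v₃, v₄, ⟨_, C.occ τ⟩, ⟨_, C.occ τ'⟩, form _, form _, h, h'⟩
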